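/- For every integer n > 25, the border rank of the rectangular matrix multiplication tensor satisfies BR(M⟨2,n,n⟩) ≥ n² + 1.32·n + 1. -/

import Mathlib

open scoped BigOperators

noncomputable section

/-- A tensor `T ∈ ℂ^{ι₁} ⊗ ℂ^{ι₂} ⊗ ℂ^{ι₃}`, written in coordinates, has rank at most `r`
if it is a sum of `r` simple tensors. -/
def rankLE {ι₁ ι₂ ι₃ : Type*} (T : ι₁ → ι₂ → ι₃ → ℂ) (r : ℕ) : Prop :=
  ∃ u : Fin r → ι₁ → ℂ, ∃ v : Fin r → ι₂ → ℂ, ∃ w : Fin r → ι₃ → ℂ,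
    T = fun i j k => ∑ l, u l i * v l j * w l k

/-- The rank of a tensor. -/
def trank {ι₁ ι₂ ι₃ : Type*} (T : ι₁ → ι₂ → ι₃ → ℂ) : ℕ :=
  sInf {r | rankLE T r}

/-- The border rank of a tensor: the least `r` such that `T` is a limit of tensors of rank
at most `r` (closure in the Euclidean = product topology). -/
def brank {ι₁ ι₂ ι₃ : Type*} [Fintype ι₁] [Fintype ι₂] [Fintype ι₃]
    (T : ι₁ → ι₂ → ι₃ → ℂ) : ℕ :=
  sInf {r | T ∈ closure {S : ι₁ → ι₂ → ι₃ → ℂ | rankLE S r}}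

/-- The matrix multiplication tensor `M⟨a,b,c⟩ = Σ e_{ij} ⊗ e_{jk} ⊗ e_{ki}`. -/
def matMulTensor (a b c : ℕ) :
    (Fin a × Fin b) → (Fin b × Fin c) → (Fin c × Fin a) → ℂ :=
  fun x y z => if x.2 = y.1 ∧ y.2 = z.1 ∧ z.2 = x.1 then 1 else 0

/-- Kronecker product of tensors. -/
def kron {ι₁ ι₂ ι₃ κ₁ κ₂ κ₃ : Type*} (T : ι₁ → ι₂ → ι₃ → ℂ) (T' : κ₁ → κ₂ → κ₃ → ℂ) :
    (ι₁ × κ₁) → (ι₂ × κ₂) → (ι₃ × κ₃) → ℂ :=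
  fun i j k => T i.1 j.1 k.1 * T' i.2 j.2 k.2

/-- The little Coppersmith–Winograd tensor
`cw_q = Σ_{i=1}^q (e₀⊗eᵢ⊗eᵢ + eᵢ⊗e₀⊗eᵢ + eᵢ⊗eᵢ⊗e₀)`. -/
def cw (q : ℕ) : Fin (q + 1) → Fin (q + 1) → Fin (q + 1) → ℂ :=
  fun i j k =>
    if (i.val = 0 ∧ j = k ∧ j.val ≠ 0) ∨ (j.val = 0 ∧ i = k ∧ i.val ≠ 0) ∨
       (k.val = 0 ∧ i = j ∧ i.val ≠ 0)
    then 1 else 0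

/-- The big Coppersmith–Winograd tensor `CW_{m-2} ∈ ℂ^m ⊗ ℂ^m ⊗ ℂ^m` (for `m ≥ 3`). -/
def bigCW (m : ℕ) : Fin m → Fin m → Fin m → ℂ :=
  fun i j k =>
    if (i.val = 0 ∧ j.val = 0 ∧ k.val = m - 1) ∨
       (i.val = 0 ∧ j.val = m - 1 ∧ k.val = 0) ∨
       (i.val = m - 1 ∧ j.val = 0 ∧ k.val = 0) ∨
       (i.val = 0 ∧ j = k ∧ 1 ≤ j.val ∧ j.val ≤ m - 2) ∨
       (j.val = 0 ∧ i = k ∧ 1 ≤ i.val ∧ i.val ≤ m - 2) ∨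
       (k.val = 0 ∧ i = j ∧ 1 ≤ i.val ∧ i.val ≤ m - 2)
    then 1 else 0

/-- The skew Coppersmith–Winograd tensor `T_{skewcw,2} ∈ ℂ³⊗ℂ³⊗ℂ³`. -/
def skewCW2 : Fin 3 → Fin 3 → Fin 3 → ℂ :=
  fun i j k =>
    if (i = 0 ∧ j = 1 ∧ k = 1) ∨ (i = 0 ∧ j = 2 ∧ k = 2) ∨ (i = 1 ∧ j = 0 ∧ k = 1) ∨
       (i = 2 ∧ j = 0 ∧ k = 2) ∨ (i = 1 ∧ j = 2 ∧ k = 0)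
    then 1
    else if i = 2 ∧ j = 1 ∧ k = 0 then -1 else 0

/-- Action of a triple of linear maps (matrices) on a tensor. -/
def triApply {a b c a' b' c' : ℕ}
    (g₁ : Matrix (Fin a') (Fin a) ℂ) (g₂ : Matrix (Fin b') (Fin b) ℂ)
    (g₃ : Matrix (Fin c') (Fin c) ℂ) (T : Fin a → Fin b → Fin c → ℂ) :
    Fin a' → Fin b' → Fin c' → ℂ :=
  fun i j k => ∑ i', ∑ j', ∑ k', g₁ i i' * g₂ j j' * g₃ k k' * T i' j' k'

/-- The unit (diagonal) tensor `I_r ∈ ℂ^r ⊗ ℂ^r ⊗ ℂ^r`. -/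
def unitTensor (r : ℕ) : Fin r → Fin r → Fin r → ℂ :=
  fun i j k => if i = j ∧ j = k then 1 else 0

/-- The unit tensor `I_r = Σ_{ℓ=1}^r a_ℓ⊗b_ℓ⊗c_ℓ` embedded in `ℂ^a ⊗ ℂ^b ⊗ ℂ^c`
(for `r ≤ min{a,b,c}`). -/
def unitIn (a b c r : ℕ) : Fin a → Fin b → Fin c → ℂ :=
  fun i j k => if i.val = j.val ∧ j.val = k.val ∧ i.val < r then 1 else 0

/-- The subrank `Q(T)`: largest `r` so that linear maps take `T` to the unit tensor `I_r`. -/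
def subrank {a b c : ℕ} (T : Fin a → Fin b → Fin c → ℂ) : ℕ :=
  sSup {r | ∃ f : Matrix (Fin r) (Fin a) ℂ, ∃ g : Matrix (Fin r) (Fin b) ℂ,
    ∃ h : Matrix (Fin r) (Fin c) ℂ, triApply f g h T = unitTensor r}

/-- The `GL(A) × GL(B) × GL(C)`-orbit of a tensor. -/
def glOrbit {a b c : ℕ} (T : Fin a → Fin b → Fin c → ℂ) :
    Set (Fin a → Fin b → Fin c → ℂ) :=
  {S | ∃ g₁ : Matrix (Fin a) (Fin a) ℂ, ∃ g₂ : Matrix (Fin b) (Fin b) ℂ,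
    ∃ g₃ : Matrix (Fin c) (Fin c) ℂ, IsUnit g₁ ∧ IsUnit g₂ ∧ IsUnit g₃ ∧
      S = triApply g₁ g₂ g₃ T}

/-- The border subrank `Q̲(T)`: largest `r` (with `r ≤ min{a,b,c}`) such that `I_r` lies in
the closure of the `GL×GL×GL`-orbit of `T`. -/
def bsubrank {a b c : ℕ} (T : Fin a → Fin b → Fin c → ℂ) : ℕ :=
  sSup {r | r ≤ min a (min b c) ∧ unitIn a b c r ∈ closure (glOrbit T)}

/-- Multilinear rank in the `A`-factor: rank of the contraction `T_A : A* → B⊗C`. -/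
def mlA {a b c : ℕ} (T : Fin a → Fin b → Fin c → ℂ) : ℕ :=
  (Matrix.of fun (i : Fin a) (p : Fin b × Fin c) => T i p.1 p.2).rank

/-- Multilinear rank in the `B`-factor. -/
def mlB {a b c : ℕ} (T : Fin a → Fin b → Fin c → ℂ) : ℕ :=
  (Matrix.of fun (j : Fin b) (p : Fin a × Fin c) => T p.1 j p.2).rank

/-- Multilinear rank in the `C`-factor. -/
def mlC {a b c : ℕ} (T : Fin a → Fin b → Fin c → ℂ) : ℕ :=
  (Matrix.of fun (k : Fin c) (p : Fin a × Fin b) => T p.1 p.2 k).rank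

/-- `T` is `1_A`-generic: some contraction `T(α) : B* → C` has full rank `m`. -/
def oneAGeneric {m : ℕ} (T : Fin m → Fin m → Fin m → ℂ) : Prop :=
  ∃ α : Fin m → ℂ, (Matrix.of fun j k => ∑ i, α i * T i j k).rank = m

def oneBGeneric {m : ℕ} (T : Fin m → Fin m → Fin m → ℂ) : Prop :=
  ∃ β : Fin m → ℂ, (Matrix.of fun i k => ∑ j, β j * T i j k).rank = m

def oneCGeneric {m : ℕ} (T : Fin m → Fin m → Fin m → ℂ) : Prop :=
  ∃ γ : Fin m → ℂ, (Matrix.of fun i j => ∑ k, γ k * T i j k).rank = m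

/-- `T` is `1`-generic. -/
def oneGeneric {m : ℕ} (T : Fin m → Fin m → Fin m → ℂ) : Prop :=
  oneAGeneric T ∧ oneBGeneric T ∧ oneCGeneric T

/-- The symmetry Lie algebra `g̃_T ⊂ gl(A) ⊕ gl(B) ⊕ gl(C)` of a tensor, as a set. -/
def symLieSet {m : ℕ} (T : Fin m → Fin m → Fin m → ℂ) :
    Set (Matrix (Fin m) (Fin m) ℂ × Matrix (Fin m) (Fin m) ℂ × Matrix (Fin m) (Fin m) ℂ) :=
  {XYZ | ∀ i j k, (∑ i', XYZ.1 i i' * T i' j k) + (∑ j', XYZ.2.1 j j' * T i j' k) +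
    (∑ k', XYZ.2.2 k k' * T i j k') = 0}


open Filter Topology

theorem limit_subspace {S ι : Type*} [Fintype ι] (𝒰 : Ultrafilter S) (e : ℕ)
    (G : S → Submodule ℂ (ι → ℂ)) (hG : ∀ᶠ s in (𝒰 : Filter S), Module.finrank ℂ (G s) = e) :
    ∃ G' : Submodule ℂ (ι → ℂ), Module.finrank ℂ G' = e ∧
      (∀ g, g ∈ G' ↔ ∃ x : S → ι → ℂ, (∀ᶠ s in (𝒰 : Filter S), x s ∈ G s) ∧
        Tendsto x 𝒰 (𝓝 g)) := by
  classical
  let G' : Submodule ℂ (ι → ℂ) :=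
    { carrier := {g | ∃ x : S → ι → ℂ, (∀ᶠ s in (𝒰 : Filter S), x s ∈ G s) ∧
        Tendsto x 𝒰 (𝓝 g)}
      add_mem' := by
        rintro a b ⟨x, hx, hx'⟩ ⟨y, hy, hy'⟩
        refine ⟨x + y, ?_, hx'.add hy'⟩
        filter_upwards [hx, hy] with s h1 h2 using (G s).add_mem h1 h2
      zero_mem' := ⟨0, by simp, tendsto_const_nhds⟩
      smul_mem' := by
        rintro c a ⟨x, hx, hx'⟩
        refine ⟨c • x, ?_, hx'.const_smul c⟩
        filter_upwards [hx] with s h1 using (G s).smul_mem c h1 }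
  refine ⟨G', ?_, fun g => Iff.rfl⟩
  let φ : EuclideanSpace ℂ ι ≃L[ℂ] (ι → ℂ) := EuclideanSpace.equiv ι ℂ
  have key : ∀ s, ∃ b : Fin e → EuclideanSpace ℂ ι, Module.finrank ℂ (G s) = e →
      Orthonormal ℂ b ∧ (∀ i, φ (b i) ∈ G s) ∧
      ∀ x, φ x ∈ G s → x = ∑ i, (inner ℂ (b i) x : ℂ) • b i := by
    intro s
    by_cases h : Module.finrank ℂ (G s) = e
    · let H : Submodule ℂ (EuclideanSpace ℂ ι) := (G s).comap φ.toLinearEquiv.toLinearMap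
      have hH : Module.finrank ℂ H = e := by
        rw [← h]
        exact (LinearEquiv.finrank_eq (Submodule.comap_equiv_self_of_inj_of_le
          (f := φ.toLinearEquiv.toLinearMap) (p := G s) φ.injective (by
            intro x _; exact ⟨φ.symm x, by simp⟩)))
      let B : OrthonormalBasis (Fin e) ℂ H := (stdOrthonormalBasis ℂ H).reindex (finCongr hH)
      refine ⟨fun i => (B i : EuclideanSpace ℂ ι), fun _ => ⟨?_, ?_, ?_⟩⟩
      · exact B.orthonormal.comp_linearIsometry H.subtypeₗᵢ
      · intro i; exact (B i).2
      · intro x hx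
        have := B.sum_repr' (⟨x, hx⟩ : H)
        have h2 := congrArg (fun z : H => (z : EuclideanSpace ℂ ι)) this
        simp only [Submodule.coe_sum, Submodule.coe_smul, Submodule.coe_inner] at h2
        exact h2.symm
    · exact ⟨0, fun h' => absurd h' h⟩
  choose b hb using key
  have hlim : ∀ i, ∃ c : EuclideanSpace ℂ ι, Tendsto (fun s => b s i) 𝒰 (𝓝 c) := by
    intro i
    have hc : IsCompact (Metric.closedBall (0 : EuclideanSpace ℂ ι) 1) :=
      isCompact_closedBall _ _
    have hm : (𝒰.map (fun s => b s i) : Filter _) ≤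
        𝓟 (Metric.closedBall (0 : EuclideanSpace ℂ ι) 1) := by
      rw [le_principal_iff]
      change ∀ᶠ s in (𝒰 : Filter S), b s i ∈ Metric.closedBall (0 : EuclideanSpace ℂ ι) 1
      filter_upwards [hG] with s hs
      simp [(hb s hs).1.1 i]
    obtain ⟨c, _, hc'⟩ := hc.ultrafilter_le_nhds _ hm
    exact ⟨c, hc'⟩
  choose c hc using hlim
  have hon : Orthonormal ℂ c := by
    rw [orthonormal_iff_ite]
    intro i j
    have h1 : Tendsto (fun s => (inner ℂ (b s i) (b s j) : ℂ)) 𝒰 (𝓝 (inner ℂ (c i) (c j))) :=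
      (hc i).inner (hc j)
    have h2 : Tendsto (fun s => (inner ℂ (b s i) (b s j) : ℂ)) 𝒰 (𝓝 (if i = j then 1 else 0)) := by
      apply tendsto_const_nhds.congr'
      filter_upwards [hG] with s hs
      exact ((orthonormal_iff_ite.1 (hb s hs).1) i j).symm
    exact tendsto_nhds_unique h1 h2
  have hG' : G' = (Submodule.span ℂ (Set.range c)).map φ.toLinearEquiv.toLinearMap := by
    apply le_antisymm
    · rintro g ⟨x, hx, hx'⟩
      refine ⟨φ.symm g, ?_, by simp⟩
      have h1 : Tendsto (fun s => φ.symm (x s)) 𝒰 (𝓝 (φ.symm g)) :=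
        (φ.symm.continuous.tendsto g).comp hx'
      have h2 : Tendsto (fun s => ∑ i, (inner ℂ (b s i) (φ.symm (x s)) : ℂ) • b s i) 𝒰
          (𝓝 (∑ i, (inner ℂ (c i) (φ.symm g) : ℂ) • c i)) := by
        apply tendsto_finsetSum
        intro i _
        exact ((hc i).inner h1).smul (hc i)
      have h3 : φ.symm g = ∑ i, (inner ℂ (c i) (φ.symm g) : ℂ) • c i := by
        refine tendsto_nhds_unique h1 (h2.congr' ?_)
        filter_upwards [hG, hx] with s hs hxs
        exact ((hb s hs).2.2 _ (by simpa using hxs)).symm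
      rw [SetLike.mem_coe, h3]
      exact Submodule.sum_mem _ fun i _ => Submodule.smul_mem _ _ (Submodule.subset_span ⟨i, rfl⟩)
    · rw [Submodule.map_span, Submodule.span_le]
      rintro _ ⟨_, ⟨i, rfl⟩, rfl⟩
      refine ⟨fun s => φ (b s i), ?_, ?_⟩
      · filter_upwards [hG] with s hs using (hb s hs).2.1 i
      · exact (φ.continuous.tendsto _).comp (hc i)
  rw [hG', LinearEquiv.finrank_map_eq, finrank_span_eq_card hon.linearIndependent]
  simp

/-- Data extracted from border apolarity in degrees (1,1), (2,1), (1,2), (2,2). -/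
def Good {X Y Z : Type*} [Fintype X] [Fintype Z] (T : X → Y → Z → ℂ) (e : ℕ) : Prop :=
  ∃ (E : Submodule ℂ (X × Z → ℂ)) (F21 : Submodule ℂ (X × X × Z → ℂ))
    (F12 : Submodule ℂ (X × Z × Z → ℂ)) (F22 : Submodule ℂ (X × X × Z × Z → ℂ)),
    Module.finrank ℂ E = e ∧ Module.finrank ℂ F21 = e ∧ Module.finrank ℂ F12 = e ∧
    Module.finrank ℂ F22 = e ∧
    (∀ y, (fun p => T p.1 y p.2) ∈ E) ∧
    (∀ f ∈ F21, (∀ x x' z, f (x, x', z) = f (x', x, z)) ∧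
      ∀ x, (fun p => f (x, p.1, p.2)) ∈ E) ∧
    (∀ f ∈ F12, (∀ x z z', f (x, z, z') = f (x, z', z)) ∧
      ∀ z, (fun p => f (p.1, z, p.2)) ∈ E) ∧
    (∀ f ∈ F22, (∀ x x' z z', f (x, x', z, z') = f (x', x, z, z')) ∧
      (∀ x x' z z', f (x, x', z, z') = f (x, x', z', z)) ∧
      ∀ x z, (fun p => f (x, p.1, z, p.2)) ∈ E)

theorem good_closed {X Y Z : Type*} [Fintype X] [Fintype Z] (e : ℕ) (T : X → Y → Z → ℂ)
    (hT : T ∈ closure {S : X → Y → Z → ℂ | Good S e}) : Good T e := by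
  obtain ⟨𝒰, h𝒰, hle⟩ := mem_closure_iff_ultrafilter.1 hT
  have key : ∀ S : X → Y → Z → ℂ, ∃ (E : Submodule ℂ (X × Z → ℂ))
    (F21 : Submodule ℂ (X × X × Z → ℂ))
    (F12 : Submodule ℂ (X × Z × Z → ℂ)) (F22 : Submodule ℂ (X × X × Z × Z → ℂ)),
    Good S e → Module.finrank ℂ E = e ∧ Module.finrank ℂ F21 = e ∧ Module.finrank ℂ F12 = e ∧
    Module.finrank ℂ F22 = e ∧
    (∀ y, (fun p => S p.1 y p.2) ∈ E) ∧
    (∀ f ∈ F21, (∀ x x' z, f (x, x', z) = f (x', x, z)) ∧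
      ∀ x, (fun p => f (x, p.1, p.2)) ∈ E) ∧
    (∀ f ∈ F12, (∀ x z z', f (x, z, z') = f (x, z', z)) ∧
      ∀ z, (fun p => f (p.1, z, p.2)) ∈ E) ∧
    (∀ f ∈ F22, (∀ x x' z z', f (x, x', z, z') = f (x', x, z, z')) ∧
      (∀ x x' z z', f (x, x', z, z') = f (x, x', z', z)) ∧
      ∀ x z, (fun p => f (x, p.1, z, p.2)) ∈ E) := by
    intro S
    by_cases h : Good S e
    · obtain ⟨E, F21, F12, F22, h'⟩ := h
      exact ⟨E, F21, F12, F22, fun _ => h'⟩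
    · exact ⟨⊥, ⊥, ⊥, ⊥, fun h' => absurd h' h⟩
  choose E F21 F12 F22 H using key
  have hg : ∀ᶠ S in (𝒰 : Filter (X → Y → Z → ℂ)), Good S e := h𝒰
  obtain ⟨E', hE', mE'⟩ := limit_subspace 𝒰 e E (by
    filter_upwards [hg] with S hS using (H S hS).1)
  obtain ⟨A', hA', mA'⟩ := limit_subspace 𝒰 e F21 (by
    filter_upwards [hg] with S hS using (H S hS).2.1)
  obtain ⟨B', hB', mB'⟩ := limit_subspace 𝒰 e F12 (by
    filter_upwards [hg] with S hS using (H S hS).2.2.1)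
  obtain ⟨C', hC', mC'⟩ := limit_subspace 𝒰 e F22 (by
    filter_upwards [hg] with S hS using (H S hS).2.2.2.1)
  refine ⟨E', A', B', C', hE', hA', hB', hC', ?_, ?_, ?_, ?_⟩
  · intro y
    rw [mE']
    refine ⟨fun S p => S p.1 y p.2, ?_, ?_⟩
    · filter_upwards [hg] with S hS using (H S hS).2.2.2.2.1 y
    · have hc : Continuous (fun (S : X → Y → Z → ℂ) (p : X × Z) => S p.1 y p.2) := by fun_prop
      exact (hc.tendsto T).mono_left hle
  · intro f hf
    obtain ⟨x, hx, hx'⟩ := (mA' f).1 hf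
    constructor
    · intro a a' z
      have h1 := (continuous_apply (a, a', z)).tendsto f |>.comp hx'
      have h2 := (continuous_apply (a', a, z)).tendsto f |>.comp hx'
      refine tendsto_nhds_unique h1 (h2.congr' ?_)
      filter_upwards [hg, hx] with S hS hxS
      exact (((H S hS).2.2.2.2.2.1 _ hxS).1 a a' z).symm
    · intro a
      rw [mE']
      refine ⟨fun S p => x S (a, p.1, p.2), ?_, ?_⟩
      · filter_upwards [hg, hx] with S hS hxS using ((H S hS).2.2.2.2.2.1 _ hxS).2 a
      · have hc : Continuous (fun (g : X × X × Z → ℂ) (p : X × Z) => g (a, p.1, p.2)) := by fun_prop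
        exact (hc.tendsto f).comp hx'
  · intro f hf
    obtain ⟨x, hx, hx'⟩ := (mB' f).1 hf
    constructor
    · intro a z z'
      have h1 := (continuous_apply (a, z, z')).tendsto f |>.comp hx'
      have h2 := (continuous_apply (a, z', z)).tendsto f |>.comp hx'
      refine tendsto_nhds_unique h1 (h2.congr' ?_)
      filter_upwards [hg, hx] with S hS hxS
      exact (((H S hS).2.2.2.2.2.2.1 _ hxS).1 a z z').symm
    · intro a
      rw [mE']
      refine ⟨fun S p => x S (p.1, a, p.2), ?_, ?_⟩
      · filter_upwards [hg, hx] with S hS hxS using ((H S hS).2.2.2.2.2.2.1 _ hxS).2 a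
      · have hc : Continuous (fun (g : X × Z × Z → ℂ) (p : X × Z) => g (p.1, a, p.2)) := by fun_prop
        exact (hc.tendsto f).comp hx'
  · intro f hf
    obtain ⟨x, hx, hx'⟩ := (mC' f).1 hf
    refine ⟨?_, ?_, ?_⟩
    · intro a a' z z'
      have h1 := (continuous_apply (a, a', z, z')).tendsto f |>.comp hx'
      have h2 := (continuous_apply (a', a, z, z')).tendsto f |>.comp hx'
      refine tendsto_nhds_unique h1 (h2.congr' ?_)
      filter_upwards [hg, hx] with S hS hxS
      exact (((H S hS).2.2.2.2.2.2.2 _ hxS).1 a a' z z').symm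
    · intro a a' z z'
      have h1 := (continuous_apply (a, a', z, z')).tendsto f |>.comp hx'
      have h2 := (continuous_apply (a, a', z', z)).tendsto f |>.comp hx'
      refine tendsto_nhds_unique h1 (h2.congr' ?_)
      filter_upwards [hg, hx] with S hS hxS
      exact (((H S hS).2.2.2.2.2.2.2 _ hxS).2.1 a a' z z').symm
    · intro a z
      rw [mE']
      refine ⟨fun S p => x S (a, p.1, z, p.2), ?_, ?_⟩
      · filter_upwards [hg, hx] with S hS hxS using ((H S hS).2.2.2.2.2.2.2 _ hxS).2.2 a z
      · have hc : Continuous (fun (g : X × X × Z × Z → ℂ) (p : X × Z) => g (a, p.1, z, p.2)) := by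
          fun_prop
        exact (hc.tendsto f).comp hx'

theorem good_of_rankLE {X Y Z : Type*} [Fintype X] [Fintype Z] (T : X → Y → Z → ℂ) (r : ℕ)
    (h : rankLE T r) : ∃ e, e ≤ r ∧ Good T e := by
  classical
  obtain ⟨u, v, w, rfl⟩ := h
  let g : Fin r → (X × Z → ℂ) := fun l p => u l p.1 * w l p.2
  obtain ⟨κ, a, ha, hspan, hli⟩ := exists_linearIndependent' ℂ g
  have : Fintype κ := Fintype.ofInjective a ha
  have hne : ∀ k : κ, ∃ x z, u (a k) x ≠ 0 ∧ w (a k) z ≠ 0 := by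
    intro k
    have := hli.ne_zero k
    obtain ⟨p, hp⟩ := Function.ne_iff.1 this
    exact ⟨p.1, p.2, left_ne_zero_of_mul hp, right_ne_zero_of_mul hp⟩
  have hli' := Fintype.linearIndependent_iff.1 hli
  have hgE : ∀ l, g l ∈ Submodule.span ℂ (Set.range (g ∘ a)) := by
    intro l; rw [hspan]; exact Submodule.subset_span ⟨l, rfl⟩
  have l21 : LinearIndependent ℂ (fun (k : κ) (p : X × X × Z) =>
      u (a k) p.1 * (u (a k) p.2.1 * w (a k) p.2.2)) := by
    rw [Fintype.linearIndependent_iff]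
    intro c hc k
    obtain ⟨x, z, hx, hz⟩ := hne k
    have := hli' (fun k => c k * u (a k) x) (by
      funext p
      have := congrFun hc (x, p.1, p.2)
      simpa [g, Finset.sum_apply, mul_assoc] using this) k
    exact (mul_eq_zero.1 this).resolve_right hx
  have l12 : LinearIndependent ℂ (fun (k : κ) (p : X × Z × Z) =>
      w (a k) p.2.1 * (u (a k) p.1 * w (a k) p.2.2)) := by
    rw [Fintype.linearIndependent_iff]
    intro c hc k
    obtain ⟨x, z, hx, hz⟩ := hne k
    have := hli' (fun k => c k * w (a k) z) (by
      funext p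
      have := congrFun hc (p.1, z, p.2)
      simpa [g, Finset.sum_apply, mul_assoc] using this) k
    exact (mul_eq_zero.1 this).resolve_right hz
  have l22 : LinearIndependent ℂ (fun (k : κ) (p : X × X × Z × Z) =>
      (u (a k) p.1 * w (a k) p.2.2.1) * (u (a k) p.2.1 * w (a k) p.2.2.2)) := by
    rw [Fintype.linearIndependent_iff]
    intro c hc k
    obtain ⟨x, z, hx, hz⟩ := hne k
    have := hli' (fun k => c k * (u (a k) x * w (a k) z)) (by
      funext p
      have := congrFun hc (x, p.1, z, p.2)
      simpa [g, Finset.sum_apply, mul_assoc] using this) k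
    exact (mul_eq_zero.1 this).resolve_right (mul_ne_zero hx hz)
  refine ⟨Fintype.card κ, by simpa using Fintype.card_le_of_injective a ha,
    Submodule.span ℂ (Set.range (g ∘ a)), Submodule.span ℂ (Set.range _),
    Submodule.span ℂ (Set.range _), Submodule.span ℂ (Set.range _),
    finrank_span_eq_card hli, finrank_span_eq_card l21, finrank_span_eq_card l12,
    finrank_span_eq_card l22, ?_, ?_, ?_, ?_⟩
  · intro y
    have : (fun p : X × Z => ∑ l, u l p.1 * v l y * w l p.2) = ∑ l, v l y • g l := by
      funext p
      simp only [Finset.sum_apply, Pi.smul_apply, smul_eq_mul, g]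
      exact Finset.sum_congr rfl fun l _ => by ring
    rw [this]
    exact Submodule.sum_mem _ fun l _ => Submodule.smul_mem _ _ (hgE l)
  · intro f hf
    induction hf using Submodule.span_induction with
    | mem f hf =>
      obtain ⟨k, rfl⟩ := hf
      refine ⟨fun x x' z => by ring, fun x => ?_⟩
      exact Submodule.smul_mem _ (u (a k) x) (hgE (a k))
    | zero => exact ⟨fun _ _ _ => rfl, fun _ => Submodule.zero_mem _⟩
    | add f f' _ _ h1 h2 =>
      exact ⟨fun x x' z => by simp [h1.1 x x' z, h2.1 x x' z],
        fun x => Submodule.add_mem _ (h1.2 x) (h2.2 x)⟩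
    | smul c f _ h1 =>
      exact ⟨fun x x' z => by simp [h1.1 x x' z], fun x => Submodule.smul_mem _ c (h1.2 x)⟩
  · intro f hf
    induction hf using Submodule.span_induction with
    | mem f hf =>
      obtain ⟨k, rfl⟩ := hf
      refine ⟨fun x x' z => by ring, fun x => ?_⟩
      exact Submodule.smul_mem _ (w (a k) x) (hgE (a k))
    | zero => exact ⟨fun _ _ _ => rfl, fun _ => Submodule.zero_mem _⟩
    | add f f' _ _ h1 h2 =>
      exact ⟨fun x x' z => by simp [h1.1 x x' z, h2.1 x x' z],
        fun x => Submodule.add_mem _ (h1.2 x) (h2.2 x)⟩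
    | smul c f _ h1 =>
      exact ⟨fun x x' z => by simp [h1.1 x x' z], fun x => Submodule.smul_mem _ c (h1.2 x)⟩
  · intro f hf
    induction hf using Submodule.span_induction with
    | mem f hf =>
      obtain ⟨k, rfl⟩ := hf
      refine ⟨fun x x' z z' => by ring, fun x x' z z' => by ring, fun x z => ?_⟩
      exact Submodule.smul_mem _ (u (a k) x * w (a k) z) (hgE (a k))
    | zero => exact ⟨fun _ _ _ _ => rfl, fun _ _ _ _ => rfl, fun _ _ => Submodule.zero_mem _⟩
    | add f f' _ _ h1 h2 =>
      exact ⟨fun x x' z z' => by simp [h1.1 x x' z z', h2.1 x x' z z'],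
        fun x x' z z' => by simp [h1.2.1 x x' z z', h2.2.1 x x' z z'],
        fun x z => Submodule.add_mem _ (h1.2.2 x z) (h2.2.2 x z)⟩
    | smul c f _ h1 =>
      exact ⟨fun x x' z z' => by simp [h1.1 x x' z z'], fun x x' z z' => by simp [h1.2.1 x x' z z'],
        fun x z => Submodule.smul_mem _ c (h1.2.2 x z)⟩

theorem good_of_closure {X Y Z : Type*} [Fintype X] [Fintype Z] (T : X → Y → Z → ℂ) (r : ℕ)
    (h : T ∈ closure {S : X → Y → Z → ℂ | rankLE S r}) : ∃ e, e ≤ r ∧ Good T e := by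
  have h1 : {S : X → Y → Z → ℂ | rankLE S r} ⊆
      ⋃ e : Fin (r + 1), {S : X → Y → Z → ℂ | Good S e} := by
    intro S hS
    obtain ⟨e, he, hg⟩ := good_of_rankLE S r hS
    exact Set.mem_iUnion.2 ⟨⟨e, by omega⟩, hg⟩
  have h2 := closure_mono h1 h
  rw [closure_iUnion_of_finite] at h2
  obtain ⟨e, he⟩ := Set.mem_iUnion.1 h2
  exact ⟨e, by omega, good_closed _ _ he⟩

theorem triangular_indep {ι κ : Type*} [Finite ι] (g : ι → κ → ℂ) (N : ι → ℕ) (pos : ι → κ)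
    (h1 : ∀ x, g x (pos x) ≠ 0)
    (h2 : ∀ x x', g x' (pos x) ≠ 0 → x' = x ∨ N x' < N x) : LinearIndependent ℂ g := by
  classical
  have := Fintype.ofFinite ι
  rw [Fintype.linearIndependent_iff]
  intro c hc
  have key : ∀ M, ∀ x, N x = M → c x = 0 := by
    intro M
    induction M using Nat.strong_induction_on with
    | _ M ih =>
      intro x hx
      have h := congrFun hc (pos x)
      rw [Finset.sum_apply, Finset.sum_eq_single x] at h
      · simpa [h1 x] using h
      · intro x' _ hne
        by_cases h3 : g x' (pos x) = 0
        · simp [h3]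
        · rcases h2 x x' h3 with h4 | h4
          · exact absurd h4 hne
          · simp [ih (N x') (hx ▸ h4) x' rfl]
      · simp
  exact fun x => key _ x rfl

open Classical in
/-- positions of leading terms -/
def lead {Q : Type*} [Fintype Q] (wt : Q → ℕ) (E : Submodule ℂ (Q → ℂ)) : Finset Q :=
  Finset.univ.filter fun z => ∃ e ∈ E, e z ≠ 0 ∧ ∀ z', wt z' < wt z → e z' = 0

theorem card_lead {Q : Type*} [Fintype Q] (wt : Q → ℕ) (hwt : Function.Injective wt)
    (E : Submodule ℂ (Q → ℂ)) : (lead wt E).card = Module.finrank ℂ E := by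
  classical
  apply le_antisymm
  · have h : ∀ z : lead wt E, ∃ e ∈ E, e z ≠ 0 ∧ ∀ z', wt z' < wt z → e z' = 0 := by
      intro z
      have := z.2
      simpa [lead] using this
    choose e he h1 h2 using h
    have hli : LinearIndependent ℂ (fun z => e z) := by
      refine triangular_indep _ (fun z => wt z) (fun z => (z : Q)) h1 ?_
      intro x x' h
      by_contra hcon
      push Not at hcon
      have : wt x ≠ wt x' := fun hh => hcon.1 (Subtype.ext (hwt hh)).symm
      exact h (h2 x' x (by have := hcon.2; omega))
    have hli2 : LinearIndependent ℂ (fun z => (⟨e z, he z⟩ : E)) :=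
      LinearIndependent.of_comp E.subtype hli
    simpa using hli2.fintype_card_le_finrank
  · let ρ : E →ₗ[ℂ] (lead wt E → ℂ) :=
      (LinearMap.funLeft ℂ ℂ (fun z : lead wt E => (z : Q))) ∘ₗ E.subtype
    have hinj : Function.Injective ρ := by
      rw [← LinearMap.ker_eq_bot, LinearMap.ker_eq_bot']
      intro e he
      have h0 : ∀ M, ∀ z, wt z = M → e.1 z = 0 := by
        intro M
        induction M using Nat.strong_induction_on with
        | _ M ih =>
          intro z hz
          by_contra hne
          have hm : z ∈ lead wt E := by
            simp only [lead, Finset.mem_filter, Finset.mem_univ, true_and]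
            exact ⟨e.1, e.2, hne, fun z' hz' => ih _ (hz ▸ hz') z' rfl⟩
          exact hne (congrFun he ⟨z, hm⟩)
      exact Subtype.ext (funext fun z => h0 _ z rfl)
    simpa using LinearMap.finrank_le_finrank_of_injective hinj

open Classical in
def Dset {I J : Type*} [Fintype I] (Y : Finset (I × J × Fin 3)) (j : J) (t : Fin 4) : Finset I :=
  Finset.univ.filter fun k => ∃ (a : Fin 2) (w : Fin 3), a.val + w.val = t.val ∧ (k, j, w) ∈ Y

open Classical in
def Mset {n : ℕ} {J : Type*} [Fintype J] (Y : Finset (Fin n × J × Fin 3)) :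
    Finset (Fin n × Fin n × J × Fin 4) :=
  Finset.univ.filter fun q => q.2.1 ∈ Dset Y q.2.2.1 q.2.2.2 ∧
    (q.1 ∉ Dset Y q.2.2.1 q.2.2.2 ∨ q.1 < q.2.1)

def Ssum {I J P : Type*} [AddCommGroup P] [Module ℂ P]
    (ev : P →ₗ[ℂ] (I × J × Fin 3 → ℂ)) (z : I × Fin 2 → P) (i k : I) (j : J) (t : Fin 4) : ℂ :=
  ∑ a : Fin 2, ∑ w : Fin 3, if a.val + w.val = t.val then ev (z (i, a)) (k, j, w) else 0

def mu {I J P : Type*} [AddCommGroup P] [Module ℂ P]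
    (ev : P →ₗ[ℂ] (I × J × Fin 3 → ℂ)) : (I × Fin 2 → P) →ₗ[ℂ] (I × I × J × Fin 4 → ℂ) where
  toFun z q := Ssum ev z q.1 q.2.1 q.2.2.1 q.2.2.2 - Ssum ev z q.2.1 q.1 q.2.2.1 q.2.2.2
  map_add' z z' := by
    funext q
    simp only [Ssum, Pi.add_apply, map_add, Fin.sum_univ_two, Fin.sum_univ_three]
    split_ifs <;> ring
  map_smul' c z := by
    funext q
    simp only [Ssum, Pi.smul_apply, map_smul, Fin.sum_univ_two, Fin.sum_univ_three,
      smul_eq_mul, RingHom.id_apply]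
    split_ifs <;> ring

theorem test_bound {n : ℕ} {J P F : Type*} [Fintype J] [AddCommGroup P] [Module ℂ P]
    [FiniteDimensional ℂ P] [AddCommGroup F] [Module ℂ F] [FiniteDimensional ℂ F]
    (ev : P →ₗ[ℂ] (Fin n × J × Fin 3 → ℂ)) (wa : Fin n → ℕ) (wb : J → ℕ)
    (Y : Finset (Fin n × J × Fin 3))
    (hY : ∀ y ∈ Y, ∃ e : P, ev e y ≠ 0 ∧ ∀ z, ev e z ≠ 0 →
      z = y ∨ wa y.1 + wb y.2.1 + y.2.2.val < wa z.1 + wb z.2.1 + z.2.2.val)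
    (ζ : F →ₗ[ℂ] (Fin n × Fin 2 → P)) (hζ : Function.Injective ζ)
    (hsym : ∀ f i k j t, Ssum ev (ζ f) i k j t = Ssum ev (ζ f) k i j t) :
    Module.finrank ℂ F + (Mset Y).card ≤ 2 * n * Module.finrank ℂ P := by
  classical
  have hker : LinearMap.range ζ ≤ LinearMap.ker (mu ev) := by
    rintro _ ⟨f, rfl⟩
    rw [LinearMap.mem_ker]
    funext q
    simp [mu, hsym f q.1 q.2.1]
  have h1 : Module.finrank ℂ F ≤ Module.finrank ℂ (LinearMap.ker (mu ev)) := by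
    rw [← LinearMap.finrank_range_of_inj hζ]
    exact Submodule.finrank_mono hker
  have h2 := LinearMap.finrank_range_add_finrank_ker (mu ev)
  have h3 : Module.finrank ℂ (Fin n × Fin 2 → P) = 2 * n * Module.finrank ℂ P := by
    rw [Module.finrank_pi_fintype]
    simp only [Finset.sum_const, Finset.card_univ, Fintype.card_prod, Fintype.card_fin, smul_eq_mul]
    ring
  have hM : ∀ q : Mset Y, ∃ (a : Fin 2) (w : Fin 3) (e : P),
      a.val + w.val = q.1.2.2.2.val ∧ ev e (q.1.2.1, q.1.2.2.1, w) ≠ 0 ∧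
      ∀ z, ev e z ≠ 0 → z = (q.1.2.1, q.1.2.2.1, w) ∨
        wa q.1.2.1 + wb q.1.2.2.1 + w.val < wa z.1 + wb z.2.1 + z.2.2.val := by
    intro q
    have := q.2
    simp only [Mset, Dset, Finset.mem_filter, Finset.mem_univ, true_and] at this
    obtain ⟨⟨a, w, haw, hy⟩, _⟩ := this
    obtain ⟨e, he, he'⟩ := hY _ hy
    exact ⟨a, w, e, haw, he, he'⟩
  choose a w e haw he he' using hM
  let g : Mset Y → (Fin n × Fin n × J × Fin 4 → ℂ) := fun q =>
    mu ev (Pi.single (q.1.1, a q) (e q))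
  have hS : ∀ (q : Mset Y) i k j (t : Fin 4), Ssum ev (Pi.single (q.1.1, a q) (e q)) i k j t =
      if i = q.1.1 then ∑ w' : Fin 3, if (a q).val + w'.val = t.val then ev (e q) (k, j, w') else 0
      else 0 := by
    intro q i k j t
    unfold Ssum
    rw [Finset.sum_eq_single (a q)]
    · by_cases hi : i = q.1.1
      · subst hi; simp
      · simp [hi]
    · intro b _ hb
      apply Finset.sum_eq_zero
      intro w' _
      simp [hb]
    · simp
  -- nonvanishing of Ssum controls the position
  have hS' : ∀ (q : Mset Y) i k j (t : Fin 4), Ssum ev (Pi.single (q.1.1, a q) (e q)) i k j t ≠ 0 →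
      i = q.1.1 ∧ ((k, j, t) = q.1.2 ∨
        wa q.1.2.1 + wb q.1.2.2.1 + q.1.2.2.2.val < wa k + wb j + t.val) := by
    intro q i k j t h
    rw [hS] at h
    split_ifs at h with hi
    · refine ⟨hi, ?_⟩
      obtain ⟨w', _, hw'⟩ := Finset.exists_ne_zero_of_sum_ne_zero h
      split_ifs at hw' with hat
      · have h5 := haw q
        rcases he' q _ hw' with h4 | h4
        · left
          simp only [Prod.mk.injEq] at h4
          obtain ⟨h6, h7, h8⟩ := h4
          have : t = q.1.2.2.2 := by
            apply Fin.ext; rw [← hat, ← h5, h8]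
          rw [h6, h7, this]
        · right
          simp only at h4
          omega
      · exact absurd rfl hw'
    · exact absurd rfl h
  have hg : LinearIndependent ℂ g := by
    refine triangular_indep g (fun q => wa q.1.1 + wa q.1.2.1 + wb q.1.2.2.1 + q.1.2.2.2.val)
      (fun q => q.1) ?_ ?_
    · intro q
      have hz : Ssum ev (Pi.single (q.1.1, a q) (e q)) q.1.2.1 q.1.1 q.1.2.2.1 q.1.2.2.2 = 0 := by
        by_contra hne
        have h6 := (hS' _ _ _ _ _ hne).1
        have := q.2
        simp only [Mset, Finset.mem_filter, Finset.mem_univ, true_and] at this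
        rw [h6] at this
        rcases this.2 with h7 | h7
        · exact h7 this.1
        · exact lt_irrefl _ h7
      change Ssum ev (Pi.single (q.1.1, a q) (e q)) q.1.1 q.1.2.1 q.1.2.2.1 q.1.2.2.2 - _ ≠ 0
      rw [hz, sub_zero, hS, if_pos rfl, Finset.sum_eq_single (w q)]
      · rw [if_pos (haw q)]; exact he q
      · intro b _ hb
        rw [if_neg]
        intro h8
        have h9 := haw q
        exact hb (Fin.ext (by omega))
      · simp
    · intro q q' hne
      change Ssum ev (Pi.single (q'.1.1, a q') (e q')) q.1.1 q.1.2.1 q.1.2.2.1 q.1.2.2.2 -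
        Ssum ev (Pi.single (q'.1.1, a q') (e q')) q.1.2.1 q.1.1 q.1.2.2.1 q.1.2.2.2 ≠ 0 at hne
      have hor : Ssum ev (Pi.single (q'.1.1, a q') (e q')) q.1.1 q.1.2.1 q.1.2.2.1 q.1.2.2.2 ≠ 0 ∨
        Ssum ev (Pi.single (q'.1.1, a q') (e q')) q.1.2.1 q.1.1 q.1.2.2.1 q.1.2.2.2 ≠ 0 := by
        by_contra hcon
        push Not at hcon
        rw [hcon.1, hcon.2] at hne
        simp at hne
      rcases hor with h5 | h5
      · obtain ⟨h6, h7⟩ := hS' _ _ _ _ _ h5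
        rcases h7 with h7 | h7
        · left
          apply Subtype.ext
          exact Prod.ext h6.symm h7.symm
        · right
          rw [h6]
          omega
      · obtain ⟨h6, h7⟩ := hS' _ _ _ _ _ h5
        rcases h7 with h7 | h7
        · exfalso
          have m1 := q.2
          have m2 := q'.2
          simp only [Mset, Finset.mem_filter, Finset.mem_univ, true_and] at m1 m2
          rw [← h7, ← h6] at m2
          simp only at m2
          rcases m1.2 with h8 | h8
          · exact h8 m2.1
          · rcases m2.2 with h9 | h9
            · exact h9 m1.1
            · exact lt_asymm h8 h9
        · right
          rw [h6]
          omega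
  have h4 : (Mset Y).card ≤ Module.finrank ℂ (LinearMap.range (mu ev)) := by
    have hli2 : LinearIndependent ℂ (fun q => (⟨g q, ⟨_, rfl⟩⟩ : LinearMap.range (mu ev))) :=
      LinearIndependent.of_comp (LinearMap.range (mu ev)).subtype hg
    simpa using hli2.fintype_card_le_finrank
  omega

theorem pair_count {n : ℕ} (D : Finset (Fin n)) :
    2 * ((Finset.univ ×ˢ D).filter fun q : Fin n × Fin n => q.1 ∉ D ∨ q.1 < q.2).card
      + D.card * D.card + D.card = 2 * n * D.card := by
  have e1 : ((Finset.univ ×ˢ D).filter fun q : Fin n × Fin n => q.1 ∉ D ∨ q.1 < q.2).card =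
      (Dᶜ ×ˢ D).card + ((D ×ˢ D).filter fun q : Fin n × Fin n => q.1 < q.2).card := by
    rw [← Finset.card_union_of_disjoint]
    · congr 1
      ext ⟨a, b⟩
      simp only [Finset.mem_filter, Finset.mem_product, Finset.mem_univ, true_and,
        Finset.mem_union, Finset.mem_compl]
      tauto
    · rw [Finset.disjoint_left]
      rintro ⟨a, b⟩ h1 h2
      simp only [Finset.mem_filter, Finset.mem_product, Finset.mem_compl] at h1 h2
      exact h1.1 h2.1.1
  have e2 : ((D ×ˢ D).filter fun q : Fin n × Fin n => q.1 < q.2).card =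
      ((D ×ˢ D).filter fun q : Fin n × Fin n => q.2 < q.1).card := by
    apply Finset.card_bij (fun q _ => (q.2, q.1))
    · rintro ⟨a, b⟩ h; simp at h ⊢; tauto
    · rintro ⟨a, b⟩ _ ⟨c, d⟩ _ h; simp at h ⊢; tauto
    · rintro ⟨a, b⟩ h; exact ⟨(b, a), by simp at h ⊢; tauto, rfl⟩
  have e3 : (D ×ˢ D).card = ((D ×ˢ D).filter fun q : Fin n × Fin n => q.1 < q.2).card +
      ((D ×ˢ D).filter fun q : Fin n × Fin n => q.2 < q.1).card + D.card := by
    have hd : D.card = ((D ×ˢ D).filter fun q : Fin n × Fin n => q.1 = q.2).card := by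
      apply Finset.card_bij (fun a _ => (a, a))
      · intro a h; simp [h]
      · intro a _ b _ h; simpa using h
      · rintro ⟨a, b⟩ h; simp at h; exact ⟨a, h.1.1, by rw [h.2]⟩
    conv_rhs => rw [hd]
    rw [← Finset.card_union_of_disjoint, ← Finset.card_union_of_disjoint]
    · congr 1
      ext ⟨a, b⟩
      simp only [Finset.mem_filter, Finset.mem_product, Finset.mem_union]
      rcases lt_trichotomy a b with h | h | h <;> tauto
    · rw [Finset.disjoint_left]
      rintro ⟨a, b⟩ h1 h2
      simp only [Finset.mem_filter, Finset.mem_union] at h1 h2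
      have := h2.2
      subst this
      simp at h1
    · rw [Finset.disjoint_left]
      rintro ⟨a, b⟩ h1 h2
      simp only [Finset.mem_filter] at h1 h2
      exact lt_asymm h1.2 h2.2
  have hc : (Dᶜ).card + D.card = n := by
    rw [Finset.card_compl]; simp
    have := Finset.card_le_univ D
    simp at this; omega
  rw [Finset.card_product] at e1 e3
  rw [e1]
  have : 2 * n * D.card = 2 * ((Dᶜ).card * D.card) + 2 * (D.card * D.card) := by
    have h5 : ∀ a b : ℕ, a + b = n → 2 * n * b = 2 * (a * b) + 2 * (b * b) := by
      intro a b h; rw [← h]; ring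
    exact h5 _ _ hc
  omega

theorem card_Mset {n : ℕ} {J : Type*} [Fintype J] (Y : Finset (Fin n × J × Fin 3)) :
    2 * (Mset Y).card + ∑ j, ∑ t, ((Dset Y j t).card * (Dset Y j t).card + (Dset Y j t).card) =
      ∑ j, ∑ t, 2 * n * (Dset Y j t).card := by
  classical
  have : (Mset Y).card = ∑ j, ∑ t, ((Finset.univ ×ˢ Dset Y j t).filter
      fun q : Fin n × Fin n => q.1 ∉ Dset Y j t ∨ q.1 < q.2).card := by
    rw [← Finset.sum_product', Finset.univ_product_univ,
      Finset.card_eq_sum_card_fiberwise (f := fun q : Fin n × Fin n × J × Fin 4 => q.2.2)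
      (t := Finset.univ) (by simp)]
    apply Finset.sum_congr rfl
    rintro ⟨j, t⟩ _
    apply Finset.card_bij (fun q _ => (q.1, q.2.1))
    · rintro ⟨a, b, c, d⟩ h
      simp [Mset] at h ⊢
      obtain ⟨h1, rfl, rfl⟩ := h
      exact h1
    · rintro ⟨a, b, c, d⟩ h ⟨a', b', c', d'⟩ h' hh
      simp [Mset] at h h' hh ⊢
      obtain ⟨_, rfl, rfl⟩ := h
      obtain ⟨_, rfl, rfl⟩ := h'
      exact ⟨hh.1, hh.2, rfl, rfl⟩
    · rintro ⟨a, b⟩ h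
      refine ⟨(a, b, j, t), ?_, rfl⟩
      simp [Mset] at h ⊢
      exact h
  rw [this, Finset.mul_sum, ← Finset.sum_add_distrib]
  apply Finset.sum_congr rfl
  intro j _
  rw [Finset.mul_sum, ← Finset.sum_add_distrib]
  apply Finset.sum_congr rfl
  intro t _
  have := pair_count (Dset Y j t)
  rw [← this]; ring

def tau (n : ℕ) : ((Fin 2 × Fin n) × (Fin n × Fin 2) → ℂ) →ₗ[ℂ] (Fin n × Fin n × Fin 3 → ℂ) where
  toFun e q := ![- e ((0, q.1), (q.2.1, 1)), e ((0, q.1), (q.2.1, 0)) - e ((1, q.1), (q.2.1, 1)),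
    e ((1, q.1), (q.2.1, 0))] q.2.2
  map_add' x y := by
    funext ⟨i, j, w⟩
    fin_cases w <;> simp <;> ring
  map_smul' c x := by
    funext ⟨i, j, w⟩
    fin_cases w <;> simp
    ring

@[simp] theorem tau_zero (n : ℕ) (e) (i j : Fin n) : tau n e (i, j, 0) = - e ((0, i), (j, 1)) := rfl
@[simp] theorem tau_one (n : ℕ) (e) (i j : Fin n) :
    tau n e (i, j, 1) = e ((0, i), (j, 0)) - e ((1, i), (j, 1)) := rfl
@[simp] theorem tau_two (n : ℕ) (e) (i j : Fin n) : tau n e (i, j, 2) = e ((1, i), (j, 0)) := rfl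

def wt3 (n : ℕ) (q : Fin n × Fin n × Fin 3) : ℕ := 3 * (n * q.1.val) + 3 * q.2.1.val + q.2.2.val

theorem wt3_inj (n : ℕ) : Function.Injective (wt3 n) := by
  rintro ⟨i, j, w⟩ ⟨i', j', w'⟩ h
  simp only [wt3] at h
  have hw := w.2
  have hw' := w'.2
  have h1 : w.val = w'.val := by omega
  have h2 : finProdFinEquiv (i, j) = finProdFinEquiv (i', j') := by
    apply Fin.ext
    simp only [finProdFinEquiv_apply_val]
    omega
  have h3 := finProdFinEquiv.injective h2
  simp only [Prod.mk.injEq] at h3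
  obtain ⟨rfl, rfl⟩ := h3
  rw [Fin.ext h1]

def swp {n : ℕ} (Y : Finset (Fin n × Fin n × Fin 3)) : Finset (Fin n × Fin n × Fin 3) :=
  Finset.univ.filter fun q => (q.2.1, q.1, q.2.2) ∈ Y

theorem rank_drop {n e : ℕ} (E : Submodule ℂ ((Fin 2 × Fin n) × (Fin n × Fin 2) → ℂ))
    (hE : Module.finrank ℂ E = e)
    (hT : ∀ y, (fun p : (Fin 2 × Fin n) × (Fin n × Fin 2) => matMulTensor 2 n n p.1 y p.2) ∈ E) :
    n * n + Module.finrank ℂ (E.map (tau n)) ≤ e := by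
  classical
  have h2 := LinearMap.finrank_range_add_finrank_ker ((tau n).domRestrict E)
  rw [LinearMap.range_domRestrict, hE] at h2
  let g : Fin n × Fin n → LinearMap.ker ((tau n).domRestrict E) := fun y =>
    ⟨⟨_, hT y⟩, by
      rw [LinearMap.mem_ker]
      funext ⟨i, j, w⟩
      fin_cases w <;> simp [matMulTensor]⟩
  have hg0 : LinearIndependent ℂ (fun y : Fin n × Fin n =>
      (fun p : (Fin 2 × Fin n) × (Fin n × Fin 2) => matMulTensor 2 n n p.1 y p.2)) := by
    refine triangular_indep _ (fun _ => 0) (fun y => ((0, y.1), (y.2, 0))) ?_ ?_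
    · intro y; simp [matMulTensor]
    · intro y y' h
      left
      simp [matMulTensor] at h
      exact Prod.ext h.1.symm h.2
  have hg : LinearIndependent ℂ g := by
    apply LinearIndependent.of_comp (E.subtype ∘ₗ (LinearMap.ker ((tau n).domRestrict E)).subtype)
    exact hg0
  have := hg.fintype_card_le_finrank
  simp at this
  omega

theorem lead_spec {n : ℕ} (E' : Submodule ℂ (Fin n × Fin n × Fin 3 → ℂ)) (y)
    (hy : y ∈ lead (wt3 n) E') : ∃ e : E', e.1 y ≠ 0 ∧ ∀ z, e.1 z ≠ 0 → z = y ∨ wt3 n y < wt3 n z := by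
  simp only [lead, Finset.mem_filter, Finset.mem_univ, true_and] at hy
  obtain ⟨e, he, h1, h2⟩ := hy
  refine ⟨⟨e, he⟩, h1, fun z hz => ?_⟩
  by_contra hcon
  push Not at hcon
  have : wt3 n z ≠ wt3 n y := fun h => hcon.1 (wt3_inj n h)
  exact hz (h2 z (by have := hcon.2; omega))

theorem test210 {n e : ℕ} (E : Submodule ℂ ((Fin 2 × Fin n) × (Fin n × Fin 2) → ℂ))
    (F : Submodule ℂ ((Fin 2 × Fin n) × (Fin 2 × Fin n) × (Fin n × Fin 2) → ℂ))
    (hF : Module.finrank ℂ F = e)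
    (h : ∀ f ∈ F, (∀ x x' z, f (x, x', z) = f (x', x, z)) ∧
      ∀ x, (fun p : (Fin 2 × Fin n) × (Fin n × Fin 2) => f (x, p.1, p.2)) ∈ E) :
    e + (Mset (lead (wt3 n) (E.map (tau n)))).card ≤ 2 * n * Module.finrank ℂ (E.map (tau n)) := by
  classical
  let ζ : F →ₗ[ℂ] (Fin n × Fin 2 → E.map (tau n)) :=
    { toFun := fun f q => ⟨tau n (fun p => f.1 ((q.2, q.1), p.1, p.2)),
        Submodule.mem_map_of_mem ((h f.1 f.2).2 _)⟩
      map_add' := by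
        intro f g; funext q; apply Subtype.ext
        exact map_add (tau n) _ _
      map_smul' := by
        intro f g; funext q; apply Subtype.ext
        exact map_smul (tau n) _ _ }
  have hζ : Function.Injective ζ := by
    rw [← LinearMap.ker_eq_bot, LinearMap.ker_eq_bot']
    intro f hf
    have hs := (h f.1 f.2).1
    have h0 : ∀ α i k j w, tau n (fun p => f.1 ((α, i), p.1, p.2)) (k, j, w) = 0 := by
      intro α i k j w
      have := congrArg Subtype.val (congrFun hf (i, α))
      exact congrFun this (k, j, w)
    have a0 : ∀ α i k j, f.1 ((α, i), (0, k), (j, 1)) = 0 := by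
      intro α i k j; simpa using h0 α i k j 0
    have a2 : ∀ α i k j, f.1 ((α, i), (1, k), (j, 0)) = 0 := by
      intro α i k j; simpa using h0 α i k j 2
    have a1 : ∀ α i k j, f.1 ((α, i), (0, k), (j, 0)) = f.1 ((α, i), (1, k), (j, 1)) := by
      intro α i k j; simpa [sub_eq_zero] using h0 α i k j 1
    apply Subtype.ext
    funext ⟨⟨α, i⟩, ⟨β, k⟩, ⟨j, γ⟩⟩
    change f.1 ((α, i), (β, k), (j, γ)) = 0
    fin_cases α <;> fin_cases β <;> fin_cases γ <;> simp only [Fin.zero_eta, Fin.mk_one, Fin.isValue]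
    · rw [a1, hs, a0]
    · rw [a0]
    · rw [a2]
    · rw [hs, a0]
    · rw [hs, a2]
    · rw [a0]
    · rw [a2]
    · rw [← a1, hs, a2]
  have := test_bound (E.map (tau n)).subtype (fun i => 3 * (n * i.val)) (fun j : Fin n => 3 * j.val)
    (lead (wt3 n) (E.map (tau n))) (fun y hy => lead_spec _ y hy) ζ hζ ?_
  · rw [hF] at this
    exact this
  · intro f i k j t
    have hs := (h f.1 f.2).1
    have e1 : ∀ α i, (E.map (tau n)).subtype (ζ f (i, α)) = tau n (fun p => f.1 ((α, i), p.1, p.2)) :=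
      fun _ _ => rfl
    fin_cases t <;> simp [Ssum, Fin.sum_univ_two, Fin.sum_univ_three, -Submodule.subtype_apply, e1]
    · rw [hs]
    · rw [hs (0, i) (0, k), hs (0, i) (1, k), hs (1, i) (0, k)]; ring
    · rw [hs (0, i) (1, k), hs (1, i) (0, k), hs (1, i) (1, k)]; ring
    · rw [hs]

theorem test120 {n e : ℕ} (E : Submodule ℂ ((Fin 2 × Fin n) × (Fin n × Fin 2) → ℂ))
    (F : Submodule ℂ ((Fin 2 × Fin n) × (Fin n × Fin 2) × (Fin n × Fin 2) → ℂ))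
    (hF : Module.finrank ℂ F = e)
    (h : ∀ f ∈ F, (∀ x z z', f (x, z, z') = f (x, z', z)) ∧
      ∀ z, (fun p : (Fin 2 × Fin n) × (Fin n × Fin 2) => f (p.1, z, p.2)) ∈ E) :
    e + (Mset (swp (lead (wt3 n) (E.map (tau n))))).card ≤
      2 * n * Module.finrank ℂ (E.map (tau n)) := by
  classical
  let sg : Fin 2 → ℂ := ![-1, 1]
  let ζ : F →ₗ[ℂ] (Fin n × Fin 2 → E.map (tau n)) :=
    { toFun := fun f q => sg q.2 • ⟨tau n (fun p => f.1 (p.1, (q.1, 1 - q.2), p.2)),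
        Submodule.mem_map_of_mem ((h f.1 f.2).2 _)⟩
      map_add' := by
        intro f g; funext q; apply Subtype.ext
        change sg q.2 • tau n (_ + _) = sg q.2 • tau n _ + sg q.2 • tau n _
        rw [map_add, smul_add]
      map_smul' := by
        intro c g; funext q; apply Subtype.ext
        change sg q.2 • tau n (c • _) = c • sg q.2 • tau n _
        rw [map_smul, smul_comm] }
  have e0 : ∀ (f : F) i, (ζ f (i, 0)).1 = - tau n (fun p => f.1 (p.1, (i, 1), p.2)) := by
    intro f i; change (-1 : ℂ) • _ = _; rw [neg_one_smul]; rfl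
  have e1 : ∀ (f : F) i, (ζ f (i, 1)).1 = tau n (fun p => f.1 (p.1, (i, 0), p.2)) := by
    intro f i; change (1 : ℂ) • _ = _; rw [one_smul]; rfl
  have hζ : Function.Injective ζ := by
    rw [← LinearMap.ker_eq_bot, LinearMap.ker_eq_bot']
    intro f hf
    have hs := (h f.1 f.2).1
    have h0 : ∀ α i k j w, tau n (fun p => f.1 (p.1, (i, α), p.2)) (k, j, w) = 0 := by
      intro α i k j w
      have t1 := congrArg Subtype.val (congrFun hf (i, 1 - α))
      have t2 := congrFun t1 (k, j, w)
      fin_cases α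
      · simpa [e1] using t2
      · simpa [e0] using t2
    have a0 : ∀ α i k j, f.1 ((0, k), (i, α), (j, 1)) = 0 := by
      intro α i k j; simpa using h0 α i k j 0
    have a2 : ∀ α i k j, f.1 ((1, k), (i, α), (j, 0)) = 0 := by
      intro α i k j; simpa using h0 α i k j 2
    have a1 : ∀ α i k j, f.1 ((0, k), (i, α), (j, 0)) = f.1 ((1, k), (i, α), (j, 1)) := by
      intro α i k j; simpa [sub_eq_zero] using h0 α i k j 1
    apply Subtype.ext
    funext ⟨⟨β, k⟩, ⟨i, α⟩, ⟨j, γ⟩⟩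
    change f.1 ((β, k), (i, α), (j, γ)) = 0
    fin_cases β <;> fin_cases α <;> fin_cases γ <;> simp only [Fin.zero_eta, Fin.mk_one, Fin.isValue]
    · rw [a1, hs, a2]
    · rw [a0]
    · rw [hs, a0]
    · rw [a0]
    · rw [a2]
    · rw [hs, a2]
    · rw [a2]
    · rw [← a1, hs, a0]
  let ev : E.map (tau n) →ₗ[ℂ] (Fin n × Fin n × Fin 3 → ℂ) :=
    (LinearMap.funLeft ℂ ℂ (fun q : Fin n × Fin n × Fin 3 => (q.2.1, q.1, q.2.2))) ∘ₗ
      (E.map (tau n)).subtype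
  have hev : ∀ x q, ev x q = x.1 (q.2.1, q.1, q.2.2) := fun _ _ => rfl
  have := test_bound ev (fun j => 3 * j.val) (fun i : Fin n => 3 * (n * i.val))
    (swp (lead (wt3 n) (E.map (tau n)))) ?_ ζ hζ ?_
  · rw [hF] at this
    exact this
  · rintro ⟨j, i, w⟩ hy
    simp only [swp, Finset.mem_filter, Finset.mem_univ, true_and] at hy
    obtain ⟨e, h1, h2⟩ := lead_spec _ _ hy
    refine ⟨e, h1, ?_⟩
    rintro ⟨j', i', w'⟩ hz
    rcases h2 _ hz with h3 | h3
    · left; simp only [Prod.mk.injEq] at h3 ⊢; tauto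
    · right; simp only [wt3] at h3 ⊢; omega
  · intro f i k j t
    have hs := (h f.1 f.2).1
    fin_cases t <;> simp [Ssum, Fin.sum_univ_two, Fin.sum_univ_three, hev, e0, e1]
    · rw [hs]
    · rw [hs _ (i, 1) (k, 0), hs _ (i, 1) (k, 1), hs _ (i, 0) (k, 1)]; ring
    · rw [hs _ (i, 1) (k, 0), hs _ (i, 0) (k, 0), hs _ (i, 0) (k, 1)]; ring
    · rw [hs]

theorem hook_zero {n : ℕ} (i0 j0 : Fin n) (I0 J0 : Finset (Fin n)) (hi0 : i0 ∈ I0) (hj0 : j0 ∈ J0)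
    (x : Fin 2 × Fin n → Fin 2 × Fin n → Fin n × Fin 2 → Fin n × Fin 2 → ℂ)
    (sx : ∀ a b c d, x a b c d = x b a c d) (sz : ∀ a b c d, x a b c d = x a b d c)
    (R1 : ∀ i j α γ b d, ¬ ((i = i0 ∧ j ∈ J0) ∨ (j = j0 ∧ i ∈ I0)) → α ≠ γ →
      x (α, i) b (j, γ) d = 0)
    (R2 : ∀ i j b d, ¬ ((i = i0 ∧ j ∈ J0) ∨ (j = j0 ∧ i ∈ I0)) →
      x (0, i) b (j, 0) d = x (1, i) b (j, 1) d)
    (z1 : ∀ α β j γ l δ, j ∈ J0 → l ∈ J0 → x (α, i0) (β, i0) (j, γ) (l, δ) = 0)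
    (z2 : ∀ α β i γ k δ, i ∈ I0 → k ∈ I0 → x (α, i) (β, k) (j0, γ) (j0, δ) = 0)
    (z3 : ∀ α k j δ, k ∈ I0 → k ≠ i0 → j ∈ J0 → j ≠ j0 → x (α, i0) (0, k) (j, 0) (j0, δ) = 0)
    (a b c d) : x a b c d = 0 := by
  set C : Fin n → Fin n → Prop := fun i j => (i = i0 ∧ j ∈ J0) ∨ (j = j0 ∧ i ∈ I0) with hC
  have two : ∀ a b c : Fin 2, a ≠ b → b ≠ c → a = c := by decide
  have R3 : ∀ i j b d, ¬ C i j → ∀ α β, x (α, i) b (j, α) d = x (β, i) b (j, β) d := by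
    intro i j b d h α β
    have := R2 i j b d h
    fin_cases α <;> fin_cases β <;> first | rfl | exact this | exact this.symm
  have ex : ∀ a : Fin 2, ∃ b, a ≠ b := by decide
  have A1 : ∀ i k j α β γ d, ¬ C i j → ¬ C k j → x (α, i) (β, k) (j, γ) d = 0 := by
    intro i k j α β γ d h1 h2
    by_cases e1 : α = γ
    · subst e1
      obtain ⟨γ', hg⟩ := ex β
      rw [R3 i j _ _ h1 α γ', sx]
      exact R1 _ _ _ _ _ _ h2 hg
    · exact R1 _ _ _ _ _ _ h1 e1
  have B1 : ∀ i j l α b γ δ, ¬ C i j → ¬ C i l → x (α, i) b (j, γ) (l, δ) = 0 := by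
    intro i j l α b γ δ h1 h2
    by_cases e1 : α = γ
    · subst e1
      obtain ⟨γ', hg⟩ := ex δ
      rw [R3 i j _ _ h1 α γ', sz]
      exact R1 _ _ _ _ _ _ h2 hg.symm
    · exact R1 _ _ _ _ _ _ h1 e1
  have K : ∀ α k j γ β δ, k ∈ I0 → j ∈ J0 → x (α, i0) (β, k) (j, γ) (j0, δ) = 0 := by
    intro α k j γ β δ hk hj
    by_cases h1 : k = i0
    · subst h1; exact z1 _ _ _ _ _ _ hj hj0
    by_cases h2 : j = j0
    · subst h2; exact z2 _ _ _ _ _ _ hi0 hk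
    have hc : ¬ C k j := by simp [hC, h1, h2]
    rw [sx]
    by_cases e1 : β = γ
    · subst e1
      rw [R3 k j _ _ hc β 0, sx]
      exact z3 _ _ _ _ hk h1 hj h2
    · exact R1 _ _ _ _ _ _ hc e1
  have main : ∀ α i β k j γ l δ, C i j → C k l → x (α, i) (β, k) (j, γ) (l, δ) = 0 := by
    intro α i β k j γ l δ h1 h2
    rcases h1 with ⟨rfl, h1⟩ | ⟨rfl, h1⟩ <;> rcases h2 with ⟨rfl, h2⟩ | ⟨rfl, h2⟩
    · exact z1 _ _ _ _ _ _ h1 h2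
    · exact K _ _ _ _ _ _ h2 h1
    · rw [sx, sz]; exact K _ _ _ _ _ _ h1 h2
    · exact z2 _ _ _ _ _ _ h1 h2
  obtain ⟨α, i⟩ := a
  obtain ⟨β, k⟩ := b
  obtain ⟨j, γ⟩ := c
  obtain ⟨l, δ⟩ := d
  by_cases c1 : C i j
  · by_cases c2 : C k l
    · exact main _ _ _ _ _ _ _ _ c1 c2
    · by_cases c3 : C k j
      · by_cases c4 : C i l
        · rw [sz]; exact main _ _ _ _ _ _ _ _ c4 c3
        · rw [sz]; exact A1 _ _ _ _ _ _ _ c4 c2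
      · rw [sx]; exact B1 _ _ _ _ _ _ _ c3 c2
  · by_cases c3 : C k j
    · by_cases c4 : C i l
      · rw [sz]; exact main _ _ _ _ _ _ _ _ c4 c3
      · exact B1 _ _ _ _ _ _ _ c1 c4
    · exact A1 _ _ _ _ _ _ _ c1 c3

def wt2 (n : ℕ) (a b : Fin 2 × Fin n) (c d : Fin n × Fin 2) : ℕ :=
  3 * (n * a.2.val) + 3 * (n * b.2.val) + 3 * c.1.val + 3 * d.1.val + a.1.val + b.1.val
    + (1 - c.2.val) + (1 - d.2.val)

theorem hook_bound {n e q : ℕ} (E : Submodule ℂ ((Fin 2 × Fin n) × (Fin n × Fin 2) → ℂ))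
    (F : Submodule ℂ ((Fin 2 × Fin n) × (Fin 2 × Fin n) × (Fin n × Fin 2) × (Fin n × Fin 2) → ℂ))
    (hF : Module.finrank ℂ F = e)
    (h : ∀ f ∈ F, (∀ x x' z z', f (x, x', z, z') = f (x', x, z, z')) ∧
      (∀ x x' z z', f (x, x', z, z') = f (x, x', z', z)) ∧
      ∀ x z, (fun p : (Fin 2 × Fin n) × (Fin n × Fin 2) => f (x, p.1, z, p.2)) ∈ E)
    (i0 j0 : Fin n) (I0 J0 : Finset (Fin n)) (hi0 : i0 ∈ I0) (hj0 : j0 ∈ J0)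
    (hI : I0.card = q) (hJ : J0.card = q)
    (hook : ∀ y ∈ lead (wt3 n) (E.map (tau n)),
      (y.1 = i0 ∧ y.2.1 ∈ J0) ∨ (y.2.1 = j0 ∧ y.1 ∈ I0)) :
    e ≤ 6 * (q * (2 * q + 1)) + 4 * ((q - 1) * (q - 1)) := by
  classical
  let S1 := Sym2 (Fin 2) × Sym2 (J0 × Fin 2)
  let S2 := Sym2 (I0 × Fin 2) × Sym2 (Fin 2)
  let S3 := Fin 2 × (I0.erase i0) × (J0.erase j0) × Fin 2
  let X := (Fin 2 × Fin n) × (Fin 2 × Fin n) × (Fin n × Fin 2) × (Fin n × Fin 2)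
  let co1 : S1 → X := fun s =>
    (((Quot.out s.1).1, i0), ((Quot.out s.1).2, i0),
      ((Quot.out s.2).1.1.1, (Quot.out s.2).1.2), ((Quot.out s.2).2.1.1, (Quot.out s.2).2.2))
  let co2 : S2 → X := fun s =>
    (((Quot.out s.1).1.2, (Quot.out s.1).1.1.1), ((Quot.out s.1).2.2, (Quot.out s.1).2.1.1),
      (j0, (Quot.out s.2).1), (j0, (Quot.out s.2).2))
  let co3 : S3 → X := fun s => ((s.1, i0), (0, s.2.1.1), (s.2.2.1.1, 0), (j0, s.2.2.2))
  let co : S1 ⊕ S2 ⊕ S3 → X := Sum.elim co1 (Sum.elim co2 co3)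
  let φ : F →ₗ[ℂ] (S1 ⊕ S2 ⊕ S3 → ℂ) := (LinearMap.funLeft ℂ ℂ co) ∘ₗ F.subtype
  have hout : ∀ (α : Type) (a b : α), Quot.out (s(a, b)) = (a, b) ∨ Quot.out (s(a, b)) = (b, a) := by
    intro α a b
    have h1 : s((Quot.out (s(a, b))).1, (Quot.out (s(a, b))).2) = s(a, b) := Quot.out_eq _
    rw [Sym2.eq_iff] at h1
    rcases h1 with h1 | h1
    · left; exact Prod.ext h1.1 h1.2
    · right; exact Prod.ext h1.1 h1.2
  have hφ : Function.Injective φ := by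
    rw [← LinearMap.ker_eq_bot, LinearMap.ker_eq_bot']
    intro f hf
    obtain ⟨sx, sz, hc⟩ := h f.1 f.2
    have z0 : ∀ s, f.1 (co s) = 0 := fun s => congrFun hf s
    have key : ∀ N, ∀ a b c d, wt2 n a b c d = N → f.1 (a, b, c, d) = 0 := by
      intro N
      induction N using Nat.strong_induction_on with
      | _ N ih =>
        have low : ∀ a b c d, wt2 n a b c d < N → f.1 (a, b, c, d) = 0 :=
          fun a b c d hlt => ih _ hlt a b c d rfl
        -- vanishing of tau at non-leading positions
        have van : ∀ β k l δ i j (w : Fin 3), ¬ ((i = i0 ∧ j ∈ J0) ∨ (j = j0 ∧ i ∈ I0)) →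
            wt3 n (i, j, w) + (3 * (n * (k : Fin n).val) + 3 * (l : Fin n).val + (β : Fin 2).val
              + (1 - (δ : Fin 2).val)) = N →
            tau n (fun p => f.1 ((β, k), p.1, (l, δ), p.2)) (i, j, w) = 0 := by
          intro β k l δ i j w hij hw
          by_contra hne
          have hm : (i, j, w) ∈ lead (wt3 n) (E.map (tau n)) := by
            simp only [lead, Finset.mem_filter, Finset.mem_univ, true_and]
            refine ⟨_, Submodule.mem_map_of_mem (hc (β, k) (l, δ)), hne, ?_⟩
            rintro ⟨i', j', w'⟩ hlt
            simp only [wt3] at hlt hw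
            fin_cases w' <;> simp at hlt
            · simp
              apply low; simp [wt2]; omega
            · simp
              rw [low, low, sub_zero]
              · simp [wt2]; omega
              · simp [wt2]; omega
            · simp
              apply low; simp [wt2]; omega
          exact hij (hook _ hm)
        let x : Fin 2 × Fin n → Fin 2 × Fin n → Fin n × Fin 2 → Fin n × Fin 2 → ℂ :=
          fun a b c d => if wt2 n a b c d = N then f.1 (a, b, c, d) else 0
        have hx : ∀ a b c d, f.1 (a, b, c, d) = 0 → x a b c d = 0 := by
          intro a b c d h0
          simp [x, h0]
        have hxx : ∀ a b c d, x a b c d = 0 := by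
          refine hook_zero i0 j0 I0 J0 hi0 hj0 x ?_ ?_ ?_ ?_ ?_ ?_ ?_
          · intro a b c d
            have : wt2 n a b c d = wt2 n b a c d := by simp only [wt2]; omega
            simp only [x, this, sx a b]
          · intro a b c d
            have : wt2 n a b c d = wt2 n a b d c := by simp only [wt2]; omega
            simp only [x, this, sz a b c d]
          · rintro i j α γ ⟨β, k⟩ ⟨l, δ⟩ hij hne
            simp only [x]
            split_ifs with hw
            · rw [sx, sz]
              simp only [wt2] at hw
              fin_cases α <;> fin_cases γ <;> simp at hne hw ⊢
              · have := van β k l δ i j 0 hij (by simp [wt3]; omega)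
                simpa using this
              · have := van β k l δ i j 2 hij (by simp [wt3]; omega)
                simpa using this
            · rfl
          · rintro i j ⟨β, k⟩ ⟨l, δ⟩ hij
            have : wt2 n (0, i) (β, k) (j, 0) (l, δ) = wt2 n (1, i) (β, k) (j, 1) (l, δ) := by
              simp [wt2]; omega
            simp only [x, this]
            split_ifs with hw
            · rw [sx, sz, sx (1, i), sz _ _ (j, 1)]
              simp [wt2] at hw
              have := van β k l δ i j 1 hij (by simp [wt3]; omega)
              simpa [sub_eq_zero] using this
            · rfl
          · intro α β j γ l δ hj hl
            apply hx
            have := z0 (Sum.inl (s(α, β), s(((⟨j, hj⟩ : J0), γ), ((⟨l, hl⟩ : J0), δ))))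
            simp only [co, co1, Sum.elim_inl] at this
            rcases hout _ α β with h1 | h1 <;>
            rcases hout _ ((⟨j, hj⟩ : J0), γ) ((⟨l, hl⟩ : J0), δ) with h2 | h2 <;>
            rw [h1, h2] at this
            · exact this
            · rw [sz]; exact this
            · rw [sx]; exact this
            · rw [sx, sz]; exact this
          · intro α β j γ l δ hj hl
            apply hx
            have := z0 (Sum.inr (Sum.inl (s(((⟨j, hj⟩ : I0), α), ((⟨l, hl⟩ : I0), β)), s(γ, δ))))
            simp only [co, co2, Sum.elim_inl, Sum.elim_inr] at this
            rcases hout _ γ δ with h1 | h1 <;>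
            rcases hout _ ((⟨j, hj⟩ : I0), α) ((⟨l, hl⟩ : I0), β) with h2 | h2 <;>
            rw [h1, h2] at this
            · exact this
            · rw [sx]; exact this
            · rw [sz]; exact this
            · rw [sx, sz]; exact this
          · intro α k j δ hk hk' hj hj'
            apply hx
            exact z0 (Sum.inr (Sum.inr (α, ⟨k, Finset.mem_erase.2 ⟨hk', hk⟩⟩,
              ⟨j, Finset.mem_erase.2 ⟨hj', hj⟩⟩, δ)))
        intro a b c d hw
        have := hxx a b c d
        simpa [x, hw] using this
    apply Subtype.ext
    funext ⟨a, b, c, d⟩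
    exact key _ a b c d rfl
  have := LinearMap.finrank_le_finrank_of_injective hφ
  rw [hF, Module.finrank_pi] at this
  have hcard : Fintype.card (S1 ⊕ S2 ⊕ S3) = 6 * (q * (2 * q + 1)) + 4 * ((q - 1) * (q - 1)) := by
    have hc2 : (q * 2 + 1).choose 2 = q * (2 * q + 1) := by
      rw [Nat.choose_two_right]
      apply Nat.div_eq_of_eq_mul_left (by norm_num)
      simp; ring
    simp only [S1, S2, S3, Fintype.card_sum, Fintype.card_prod, Sym2.card, Fintype.card_fin,
      Fintype.card_coe, Finset.card_erase_of_mem hi0, Finset.card_erase_of_mem hj0, hI, hJ, hc2]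
    have : Nat.choose (2 + 1) 2 = 3 := rfl
    rw [this]; ring
  omega

def colC {n : ℕ} (C : Finset (Fin n × Fin n)) (j : Fin n) : ℕ := (C.filter fun c => c.2 = j).card
def tr {n : ℕ} (C : Finset (Fin n × Fin n)) : Finset (Fin n × Fin n) := C.image Prod.swap
def Qs {n : ℕ} (C : Finset (Fin n × Fin n)) : ℕ := ∑ j, colC C j * colC C j

theorem mem_tr {n : ℕ} (C : Finset (Fin n × Fin n)) (a b) : (a, b) ∈ tr C ↔ (b, a) ∈ C := by
  simp [tr]

theorem tr_tr {n : ℕ} (C : Finset (Fin n × Fin n)) : tr (tr C) = C := by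
  ext ⟨a, b⟩; rw [mem_tr, mem_tr]

theorem card_tr {n : ℕ} (C : Finset (Fin n × Fin n)) : (tr C).card = C.card :=
  Finset.card_image_of_injective _ Prod.swap_injective

theorem sum_colC {n : ℕ} (C : Finset (Fin n × Fin n)) : ∑ j, colC C j = C.card :=
  (Finset.card_eq_sum_card_fiberwise (by simp)).symm

theorem colC_tr {n : ℕ} (C : Finset (Fin n × Fin n)) (i : Fin n) :
    colC (tr C) i = ∑ j, if (i, j) ∈ C then 1 else 0 := by
  rw [Finset.sum_boole, colC, Nat.cast_id]
  apply Finset.card_bij (fun c _ => c.1)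
  · rintro ⟨a, b⟩ h
    simp only [Finset.mem_filter, mem_tr] at h
    obtain ⟨h, rfl⟩ := h
    simpa using h
  · rintro ⟨a, b⟩ h ⟨a', b'⟩ h' hh
    simp only [Finset.mem_filter] at h h'
    exact Prod.ext hh (h.2.trans h'.2.symm)
  · intro a h
    refine ⟨(a, i), ?_, rfl⟩
    simpa [mem_tr] using h

theorem colC_split {n : ℕ} (C : Finset (Fin n × Fin n)) (i0 j : Fin n) :
    colC C j = (if (i0, j) ∈ C then 1 else 0) + colC (C.filter fun c => c.1 ≠ i0) j := by
  have h := Finset.card_filter_add_card_filter_not (s := C.filter fun c => c.2 = j) (fun c => c.1 = i0)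
  rw [colC, ← h]
  congr 1
  · have : (C.filter fun c => c.2 = j).filter (fun c => c.1 = i0) = if (i0, j) ∈ C then {(i0, j)} else ∅ := by
      ext ⟨a, b⟩
      split_ifs with h1
      · simp only [Finset.mem_filter, Finset.mem_singleton, Prod.mk.injEq]
        constructor
        · tauto
        · rintro ⟨rfl, rfl⟩; exact ⟨⟨h1, rfl⟩, rfl⟩
      · simp only [Finset.mem_filter, Finset.notMem_empty, iff_false]
        rintro ⟨⟨h2, rfl⟩, rfl⟩; exact h1 h2
    rw [this]; split_ifs <;> simp
  · rw [colC, Finset.filter_filter, Finset.filter_filter]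
    congr 1
    ext c; simp only [Finset.mem_filter]; tauto

theorem Q_bound1 {n : ℕ} (C : Finset (Fin n × Fin n)) (i0 : Fin n) (q : ℕ)
    (hq : ∀ j, colC C j ≤ q) : Qs C + q * colC (tr C) i0 ≤ (q + 1) * C.card := by
  rw [Qs, ← sum_colC C, colC_tr, Finset.mul_sum, Finset.mul_sum, ← Finset.sum_add_distrib]
  apply Finset.sum_le_sum
  intro j _
  have h1 := hq j
  have h2 := colC_split C i0 j
  split_ifs at h2 ⊢
  · obtain ⟨d, hd⟩ := Nat.exists_eq_add_of_le h1
    rw [h2] at hd ⊢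
    subst hd
    nlinarith
  · nlinarith

theorem Q_bound2 {n : ℕ} (C : Finset (Fin n × Fin n)) (i0 j0 : Fin n) :
    Qs C + (if (i0, j0) ∈ C then 1 else 0) ≤ colC C j0 * colC C j0 + colC (tr C) i0 +
      2 * (C.filter fun c => c.1 ≠ i0 ∧ c.2 ≠ j0).card +
      Qs (C.filter fun c => c.1 ≠ i0 ∧ c.2 ≠ j0) := by
  set O := C.filter fun c => c.1 ≠ i0 ∧ c.2 ≠ j0 with hO
  have hO0 : colC O j0 = 0 := by
    rw [colC, Finset.card_eq_zero, hO, Finset.filter_filter]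
    apply Finset.filter_false_of_mem
    rintro c _ h; exact h.1.2 h.2
  have hOj : ∀ j, j ≠ j0 → colC (C.filter fun c => c.1 ≠ i0) j = colC O j := by
    intro j hj
    rw [colC, colC, hO, Finset.filter_filter, Finset.filter_filter]
    congr 1
    ext c
    simp only [Finset.mem_filter]
    constructor
    · rintro ⟨h1, h2, rfl⟩; exact ⟨h1, ⟨h2, hj⟩, rfl⟩
    · tauto
  rw [← sum_colC O, Qs, Qs, colC_tr, ← Finset.add_sum_erase _ _ (Finset.mem_univ j0),
    ← Finset.add_sum_erase (a := j0) Finset.univ (fun j => if (i0, j) ∈ C then 1 else 0) (Finset.mem_univ j0),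
    ← Finset.add_sum_erase (a := j0) Finset.univ (fun j => colC O j) (Finset.mem_univ j0),
    ← Finset.add_sum_erase (a := j0) Finset.univ (fun j => colC O j * colC O j) (Finset.mem_univ j0), hO0]
  have : ∑ j ∈ Finset.univ.erase j0, colC C j * colC C j ≤
      ∑ j ∈ Finset.univ.erase j0, ((if (i0, j) ∈ C then 1 else 0) + 2 * colC O j + colC O j * colC O j) := by
    apply Finset.sum_le_sum
    intro j hj
    rw [colC_split C i0 j, hOj j (Finset.ne_of_mem_erase hj)]
    split_ifs <;> nlinarith
  rw [Finset.sum_add_distrib, Finset.sum_add_distrib, ← Finset.mul_sum] at this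
  omega

theorem Q_pair {n : ℕ} (O : Finset (Fin n × Fin n)) :
    Qs O + Qs (tr O) ≤ O.card * O.card + O.card := by
  have e1 : Qs O = ∑ c ∈ O, colC O c.2 := by
    rw [← Finset.sum_fiberwise' O (fun c => c.2) (fun j => colC O j), Qs]
    apply Finset.sum_congr rfl
    intro j _
    rw [Finset.sum_const, smul_eq_mul, colC]
  have hrow : ∀ i, colC (tr O) i = (O.filter fun c => c.1 = i).card := by
    intro i
    apply Finset.card_bij (fun c _ => c.swap)
    · rintro ⟨a, b⟩ h; simpa [mem_tr] using h
    · rintro a _ b _ h; exact Prod.swap_injective h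
    · rintro ⟨a, b⟩ h; exact ⟨(b, a), by simpa [mem_tr] using h, rfl⟩
  have e2 : Qs (tr O) = ∑ c ∈ O, colC (tr O) c.1 := by
    rw [← Finset.sum_fiberwise' O (fun c => c.1) (fun j => colC (tr O) j), Qs]
    apply Finset.sum_congr rfl
    intro j _
    rw [Finset.sum_const, smul_eq_mul, hrow]
  rw [e1, e2, ← Finset.sum_add_distrib]
  calc _ ≤ ∑ c ∈ O, (O.card + 1) := by
        apply Finset.sum_le_sum
        intro c _
        rw [hrow, colC, ← Finset.card_union_add_card_inter]
        apply add_le_add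
        · apply Finset.card_le_card
          intro x hx
          simp only [Finset.mem_union, Finset.mem_filter] at hx
          tauto
        · rw [Finset.card_le_one]
          intro a ha b hb
          simp only [Finset.mem_inter, Finset.mem_filter] at ha hb
          exact Prod.ext (ha.2.2.trans hb.2.2.symm) (ha.1.2.trans hb.1.2.symm)
    _ = _ := by rw [Finset.sum_const, smul_eq_mul]; ring

theorem card_split {n : ℕ} (C : Finset (Fin n × Fin n)) (i0 j0 : Fin n) :
    C.card + (if (i0, j0) ∈ C then 1 else 0) = colC C j0 + colC (tr C) i0 +
      (C.filter fun c => c.1 ≠ i0 ∧ c.2 ≠ j0).card := by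
  have h1 := colC_split C i0 j0
  have h2 := Finset.card_filter_add_card_filter_not (s := C) (fun c => c.1 = i0)
  have h3 := Finset.card_filter_add_card_filter_not (s := C.filter fun c => ¬ c.1 = i0) (fun c => c.2 = j0)
  have hrow : colC (tr C) i0 = (C.filter fun c => c.1 = i0).card := by
    apply Finset.card_bij (fun c _ => c.swap)
    · rintro ⟨a, b⟩ h; simpa [mem_tr] using h
    · rintro a _ b _ h; exact Prod.swap_injective h
    · rintro ⟨a, b⟩ h; exact ⟨(b, a), by simpa [mem_tr] using h, rfl⟩
  rw [Finset.filter_filter, Finset.filter_filter] at h3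
  rw [colC, colC, Finset.filter_filter] at h1
  rw [hrow, colC]
  simp only [ne_eq] at *
  omega

theorem PQ_bound {n : ℕ} (C : Finset (Fin n × Fin n)) (i0 j0 : Fin n) :
    ∃ ε w : ℕ, ε ≤ 1 ∧ C.card + ε = colC C j0 + colC (tr C) i0 + w ∧
      w = (C.filter fun c => c.1 ≠ i0 ∧ c.2 ≠ j0).card ∧ (ε = 1 ↔ (i0, j0) ∈ C) ∧ 
      Qs C + Qs (tr C) + 2 * ε ≤ colC C j0 * colC C j0 + colC (tr C) i0 * colC (tr C) i0 +
        colC C j0 + colC (tr C) i0 + w * w + 5 * w := by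
  refine ⟨if (i0, j0) ∈ C then 1 else 0, (C.filter fun c => c.1 ≠ i0 ∧ c.2 ≠ j0).card, ?_,
    card_split C i0 j0, rfl, ?_, ?_⟩
  · split_ifs <;> simp
  · split_ifs with h <;> simp [h]
  · have h1 := Q_bound2 C i0 j0
    have h2 := Q_bound2 (tr C) j0 i0
    have h3 := Q_pair (C.filter fun c => c.1 ≠ i0 ∧ c.2 ≠ j0)
    have e1 : ((tr C).filter fun c => c.1 ≠ j0 ∧ c.2 ≠ i0) =
        tr (C.filter fun c => c.1 ≠ i0 ∧ c.2 ≠ j0) := by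
      ext ⟨a, b⟩
      simp only [mem_tr, Finset.mem_filter]
      tauto
    rw [e1, card_tr, tr_tr] at h2
    simp only [mem_tr] at h2
    omega

/-- cells -/
def cells {n : ℕ} (Y : Finset (Fin n × Fin n × Fin 3)) : Finset (Fin n × Fin n) :=
  Finset.univ.filter fun c => ∃ w, (c.1, c.2, w) ∈ Y

theorem cells_swp {n : ℕ} (Y : Finset (Fin n × Fin n × Fin 3)) : cells (swp Y) = tr (cells Y) := by
  ext ⟨a, b⟩
  rw [mem_tr]
  simp [cells, swp]

theorem card_swp {n : ℕ} (Y : Finset (Fin n × Fin n × Fin 3)) : (swp Y).card = Y.card := by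
  apply Finset.card_bij (fun c _ => (c.2.1, c.1, c.2.2))
  · rintro ⟨a, b, c⟩ h; simpa [swp] using h
  · rintro ⟨a, b, c⟩ _ ⟨a', b', c'⟩ _ h; simp at h ⊢; tauto
  · rintro ⟨a, b, c⟩ h; exact ⟨(b, a, c), by simpa [swp] using h, rfl⟩

theorem shadow_card (S : Finset (Fin 3)) (hS : S.Nonempty) : S.card + 1 ≤
    (Finset.univ.filter fun t : Fin 4 => ∃ (a : Fin 2) (w : Fin 3), a.val + w.val = t.val ∧ w ∈ S).card := by
  revert S
  decide

theorem main_ineq {n e : ℕ} (Y : Finset (Fin n × Fin n × Fin 3)) (hn : 1 ≤ n)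
    (h1 : n * n + Y.card ≤ e) (h2 : e + (Mset Y).card ≤ 2 * n * Y.card) :
    (cells Y).card ≤ Y.card ∧ Y.card ≤ 3 * (cells Y).card ∧
    2 * n * n + (2 * n - 1) * (cells Y).card ≤ (2 * n - 1) * Y.card + 4 * Qs (cells Y) ∧
    (Y.card = (cells Y).card → n * n ≤ Qs (cells Y)) := by
  classical
  let S : Fin n → Fin n → Finset (Fin 3) := fun k j => Finset.univ.filter fun w => (k, j, w) ∈ Y
  let mj : Fin n → ℕ := fun j => ∑ k, (S k j).card
  have hS : ∀ k j, (S k j).Nonempty ↔ (k, j) ∈ cells Y := by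
    intro k j
    simp [S, cells, Finset.filter_nonempty_iff]
  have hcol : ∀ j, colC (cells Y) j = ∑ k, if (S k j).Nonempty then 1 else 0 := by
    intro j
    have := colC_tr (tr (cells Y)) j
    rw [tr_tr] at this
    rw [this]
    apply Finset.sum_congr rfl
    intro k _
    simp only [hS, mem_tr]
  have hm : ∑ j, mj j = Y.card := by
    simp only [mj, S, Finset.card_filter]
    rw [Finset.sum_comm, ← Finset.sum_product', Finset.univ_product_univ, ← Finset.sum_product',
      Finset.univ_product_univ, Finset.sum_boole]
    simp only [Nat.cast_id]
    apply Finset.card_bij (fun c _ => (c.1.1, c.1.2, c.2))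
    · rintro ⟨⟨a, b⟩, c⟩ h; simpa using h
    · rintro ⟨⟨a, b⟩, c⟩ _ ⟨⟨a', b'⟩, c'⟩ _ h; simp at h ⊢; tauto
    · rintro ⟨a, b, c⟩ h; exact ⟨((a, b), c), by simpa using h, rfl⟩
  have hlow : ∀ j, colC (cells Y) j ≤ mj j := by
    intro j
    rw [hcol]
    apply Finset.sum_le_sum
    intro k _
    split_ifs with h
    · exact h.card_pos
    · exact Nat.zero_le _
  have hhigh : ∀ j, mj j ≤ 3 * colC (cells Y) j := by
    intro j
    rw [hcol, Finset.mul_sum]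
    apply Finset.sum_le_sum
    intro k _
    split_ifs with h
    · simpa using Finset.card_le_univ (S k j)
    · rw [Finset.not_nonempty_iff_eq_empty] at h; simp [h]
  have hD : ∀ j t, (Dset Y j t).card ≤ colC (cells Y) j := by
    intro j t
    rw [hcol, Finset.sum_boole, Nat.cast_id]
    apply Finset.card_le_card
    intro k hk
    simp only [Dset, Finset.mem_filter, Finset.mem_univ, true_and] at hk ⊢
    obtain ⟨a, w, _, h⟩ := hk
    exact ⟨w, by simpa [S] using h⟩
  have hDs : ∀ j, mj j + colC (cells Y) j ≤ ∑ t, (Dset Y j t).card := by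
    intro j
    rw [hcol]
    simp only [mj, Dset]
    simp only [Finset.card_filter (fun k => _) (Finset.univ : Finset (Fin n))]
    rw [← Finset.sum_add_distrib, Finset.sum_comm]
    apply Finset.sum_le_sum
    intro k _
    split_ifs with h
    · have := shadow_card _ h
      refine le_trans this (le_of_eq ?_)
      rw [Finset.card_filter]
      apply Finset.sum_congr rfl
      intro t _
      simp [S]
    · rw [Finset.not_nonempty_iff_eq_empty] at h; simp [h]
  have hcn : ∀ j, colC (cells Y) j ≤ n := by
    intro j
    rw [hcol, Finset.sum_boole, Nat.cast_id]
    simpa using Finset.card_le_univ (Finset.univ.filter fun k => (S k j).Nonempty)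
  have hper : ∀ j, (2 * n - 1 : ℤ) * (mj j + colC (cells Y) j) -
      colC (cells Y) j * (mj j + colC (cells Y) j) ≤
      ∑ t, ((2 * n * (Dset Y j t).card : ℤ) - ((Dset Y j t).card * (Dset Y j t).card + (Dset Y j t).card)) := by
    intro j
    have a1 : ∀ t, (2 * n - 1 - colC (cells Y) j : ℤ) * (Dset Y j t).card ≤ 
        (2 * n * (Dset Y j t).card : ℤ) - ((Dset Y j t).card * (Dset Y j t).card + (Dset Y j t).card) := by
      intro t
      have : ((Dset Y j t).card : ℤ) ≤ colC (cells Y) j := by exact_mod_cast hD j t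
      nlinarith [this, Int.natCast_nonneg (Dset Y j t).card]
    refine le_trans ?_ (Finset.sum_le_sum fun t _ => a1 t)
    rw [← Finset.mul_sum, ← sub_mul]
    apply mul_le_mul_of_nonneg_left
    · exact_mod_cast hDs j
    · have : (colC (cells Y) j : ℤ) ≤ n := by exact_mod_cast hcn j
      have : (1 : ℤ) ≤ n := by exact_mod_cast hn
      linarith
  have hM := card_Mset Y
  have hMZ : (2 * (Mset Y).card : ℤ) = ∑ j, ∑ t, ((2 * n * (Dset Y j t).card : ℤ) -
      ((Dset Y j t).card * (Dset Y j t).card + (Dset Y j t).card)) := by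
    simp only [Finset.sum_sub_distrib]
    rw [eq_sub_iff_add_eq]
    exact_mod_cast hM
  have hsum := Finset.sum_le_sum fun j (_ : j ∈ Finset.univ) => hper j
  rw [← hMZ, Finset.sum_sub_distrib, ← Finset.mul_sum, Finset.sum_add_distrib] at hsum
  have hm' : ∑ j, (mj j : ℤ) = Y.card := by exact_mod_cast hm
  have hy' : ∑ j, (colC (cells Y) j : ℤ) = (cells Y).card := by exact_mod_cast sum_colC (cells Y)
  rw [hm', hy'] at hsum
  have hle : (cells Y).card ≤ Y.card := by
    rw [← hm, ← sum_colC]; exact Finset.sum_le_sum fun j _ => hlow j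
  have h1' : (n * n + Y.card : ℤ) ≤ e := by exact_mod_cast h1
  have h2' : (e + (Mset Y).card : ℤ) ≤ 2 * n * Y.card := by exact_mod_cast h2
  have hcast : ((2 * n - 1 : ℕ) : ℤ) = 2 * n - 1 := by
    rw [Nat.cast_sub (by omega)]; push_cast; ring
  refine ⟨hle, ?_, ?_, ?_⟩
  · rw [← hm, ← sum_colC, Finset.mul_sum]; exact Finset.sum_le_sum fun j _ => hhigh j
  · have hb : ∑ j, (colC (cells Y) j * (mj j + colC (cells Y) j) : ℤ) ≤ 4 * Qs (cells Y) := by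
      rw [Qs]; push_cast
      rw [Finset.mul_sum]
      apply Finset.sum_le_sum
      intro j _
      have : (mj j : ℤ) ≤ 3 * colC (cells Y) j := by exact_mod_cast hhigh j
      nlinarith [Int.natCast_nonneg (colC (cells Y) j)]
    zify
    rw [hcast]
    nlinarith
  · intro heq
    have hmq : ∀ j, mj j = colC (cells Y) j := by
      have : ∑ j, colC (cells Y) j = ∑ j, mj j := by rw [hm, sum_colC, heq]
      rw [Finset.sum_eq_sum_iff_of_le (fun j _ => hlow j)] at this
      exact fun j => (this j (Finset.mem_univ j)).symm
    have hb : ∑ j, (colC (cells Y) j * (mj j + colC (cells Y) j) : ℤ) = 2 * Qs (cells Y) := by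
      rw [Qs]; push_cast
      rw [Finset.mul_sum]
      apply Finset.sum_congr rfl
      intro j _
      rw [hmq]; ring
    zify
    rw [hb, ← heq] at hsum
    nlinarith

theorem num_large (n m y : ℤ) (hn : 53 ≤ n) (hm : 25 * m ≤ 33 * n + 24) (h1 : y ≤ m)
    (h2 : m ≤ 3 * y) (H : 2 * n * n + 2 * n * y + m ≤ 2 * n * m + y + (y * y + 4 * y)) : False := by
  have hy : 0 ≤ y := by linarith
  rcases le_total (75 * y) (33 * n + 24) with h | h
  · have a1 : (2 * n - 1) * (m - y) ≤ (2 * n - 1) * (2 * y) :=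
      mul_le_mul_of_nonneg_left (by linarith) (by linarith)
    have a2 : 75 * (n * y) ≤ n * (33 * n + 24) := by nlinarith
    have a3 : 75 * y * (75 * y) ≤ (33 * n + 24) * (33 * n + 24) := by
      apply mul_self_le_mul_self <;> linarith
    nlinarith
  · have a1 : (2 * n - 1) * (25 * (m - y)) ≤ (2 * n - 1) * (33 * n + 24 - 25 * y) :=
      mul_le_mul_of_nonneg_left (by linarith) (by linarith)
    have a2 : 0 ≤ (75 * y - (33 * n + 24)) * ((33 * n + 24) - 25 * y) :=
      mul_nonneg (by linarith) (by linarith)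
    have a3 : 0 ≤ (n - 27) * (75 * y - (33 * n + 24)) := mul_nonneg (by linarith) (by linarith)
    nlinarith

def chkA (a y : ℕ) : Prop := y ≤ (33 * (a + 26) + 24) / 25 →
    2 * (a + 26) * (a + 26) + 2 * (a + 26) * y + min (3 * y) ((33 * (a + 26) + 24) / 25) ≤
      2 * (a + 26) * min (3 * y) ((33 * (a + 26) + 24) / 25) + y + (y * y + 4 * y) →
    (a, y) ∈ [(0, 35), (0, 12), (1, 12), (9, 16), (10, 16), (18, 20), (3, 13), (6, 15), (12, 17),
      (21, 21)]

instance (a y : ℕ) : Decidable (chkA a y) := by unfold chkA; infer_instance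

theorem num_check : ∀ a < 27, ∀ y < 70, chkA a y := by
  decide +kernel

theorem num_small (n m y : ℕ) (hn : 26 ≤ n) (hn' : n ≤ 52) (hm : 25 * m ≤ 33 * n + 24) (h1 : y ≤ m)
    (h2 : m ≤ 3 * y) (H : 2 * n * n + 2 * n * y + m ≤ 2 * n * m + y + (y * y + 4 * y))
    (H1 : m = y → 4 * (n * n) ≤ y * y + 4 * y) :
    (n = 26 ∧ y = 12) ∨ (n = 27 ∧ y = 12) ∨ (n = 35 ∧ y = 16) ∨ (n = 36 ∧ y = 16) ∨
    (n = 44 ∧ y = 20) ∨ (n = 29 ∧ y = 13) ∨ (n = 32 ∧ y = 15) ∨ (n = 38 ∧ y = 17) ∨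
    (n = 47 ∧ y = 21) := by
  obtain ⟨a, rfl⟩ := Nat.exists_eq_add_of_le' hn
  have hmm : m ≤ min (3 * y) ((33 * (a + 26) + 24) / 25) := by
    apply le_min h2
    omega
  have hc := num_check a (by omega) y (by omega) (by omega) ?_
  · clear H hmm
    simp only [List.mem_cons, Prod.mk.injEq, List.not_mem_nil, or_false] at hc
    rcases hc with ⟨rfl, rfl⟩ | hc
    · have : m = 35 := by omega
      have := H1 this
      norm_num at this
    · rcases hc with ⟨rfl, rfl⟩ | ⟨rfl, rfl⟩ | ⟨rfl, rfl⟩ | ⟨rfl, rfl⟩ | ⟨rfl, rfl⟩ | ⟨rfl, rfl⟩ |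
        ⟨rfl, rfl⟩ | ⟨rfl, rfl⟩ | ⟨rfl, rfl⟩ <;> simp
  · obtain ⟨d, hd⟩ := Nat.exists_eq_add_of_le hmm
    rw [hd]
    nlinarith

def chkB (y p q ε K : ℕ) : Prop := q + p ≤ y + ε →
    K + q * p ≤ (q + 1) * y → K + p * q ≤ (p + 1) * y →
    2 * K + 2 * ε ≤ q * q + p * p + q + p + (y + ε - (q + p)) * (y + ε - (q + p)) +
      5 * (y + ε - (q + p)) →
    p = q ∧ ε = 1 ∧ y + 1 = 2 * q ∧ y ≠ 12 ∧ y ≠ 16 ∧ y ≠ 20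

instance (y p q ε K : ℕ) : Decidable (chkB y p q ε K) := by unfold chkB; infer_instance

theorem hook_check :
    ∀ K ∈ [(12, 45), (13, 50), (15, 71), (16, 78), (17, 85), (20, 120), (21, 128)],
    ∀ p < 23, ∀ q < 23, ∀ ε < 2, chkB K.1 p q ε K.2 := by
  decide +kernel

theorem quarter (y p q Q : ℕ) (hpq : q ≤ p) (h : Q + q * p ≤ (q + 1) * y) : 4 * Q ≤ y * y + 4 * y := by
  zify at *
  nlinarith [sq_nonneg ((y : ℤ) - 2 * q)]

theorem num_final (n m y p q P Q ε w : ℕ) (hn : 26 ≤ n) (hm : 25 * m ≤ 33 * n + 24) (h1 : y ≤ m)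
    (h2 : m ≤ 3 * y) (hU : 2 * n * n + 2 * n * y + m ≤ 2 * n * m + y + 4 * Q)
    (hW : 2 * n * n + 2 * n * y + m ≤ 2 * n * m + y + 4 * P)
    (hU1 : m = y → n * n ≤ Q) (hW1 : m = y → n * n ≤ P)
    (c1 : Q + q * p ≤ (q + 1) * y) (c1' : P + p * q ≤ (p + 1) * y)
    (hε : ε ≤ 1) (hw : y + ε = q + p + w)
    (c2 : Q + P + 2 * ε ≤ q * q + p * p + q + p + w * w + 5 * w) :
    p = q ∧ ε = 1 ∧ w = 0 ∧
      ((n = 29 ∧ q = 7) ∨ (n = 32 ∧ q = 8) ∨ (n = 38 ∧ q = 9) ∨ (n = 47 ∧ q = 11)) := by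
  obtain ⟨H, H1⟩ : (2 * n * n + 2 * n * y + m ≤ 2 * n * m + y + (y * y + 4 * y)) ∧
      (m = y → 4 * (n * n) ≤ y * y + 4 * y) := by
    rcases le_total q p with h | h
    · have := quarter y p q Q h c1
      exact ⟨by omega, fun h => by have := hU1 h; omega⟩
    · have := quarter y q p P h c1'
      exact ⟨by omega, fun h => by have := hW1 h; omega⟩
  have hn' : n ≤ 52 := by
    by_contra hcon
    push Not at hcon
    apply num_large n m y (by omega) (by omega) (by omega) (by omega)
    exact_mod_cast H
  have hp : p ≤ y + 1 := by omega
  have hq : q ≤ y + 1 := by omega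
  have hwe : w = y + ε - (q + p) := by omega
  rw [hwe] at c2
  have fin : ∀ K, (y, K) ∈ [(12, 45), (13, 50), (15, 71), (16, 78), (17, 85), (20, 120), (21, 128)] →
      K ≤ Q → K ≤ P → y < 22 →
      p = q ∧ ε = 1 ∧ y + 1 = 2 * q ∧ y ≠ 12 ∧ y ≠ 16 ∧ y ≠ 20 := by
    intro K hK hKQ hKP hy
    have hh := hook_check (y, K) hK p (by omega) q (by omega) ε (by omega)
    change chkB y p q ε K at hh
    unfold chkB at hh
    exact hh (by omega) (by omega) (by omega) (by omega)
  rcases num_small n m y hn hn' hm h1 h2 H H1 with ⟨rfl, rfl⟩ | ⟨rfl, rfl⟩ | ⟨rfl, rfl⟩ | ⟨rfl, rfl⟩ |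
    ⟨rfl, rfl⟩ | ⟨rfl, rfl⟩ | ⟨rfl, rfl⟩ | ⟨rfl, rfl⟩ | ⟨rfl, rfl⟩ <;> clear H H1 hU1 hW1
  · have := fin 45 (by simp) (by omega) (by omega) (by omega); omega
  · have := fin 45 (by simp) (by omega) (by omega) (by omega); omega
  · have := fin 78 (by simp) (by omega) (by omega) (by omega); omega
  · have := fin 78 (by simp) (by omega) (by omega) (by omega); omega
  · have := fin 120 (by simp) (by omega) (by omega) (by omega); omega
  · have := fin 50 (by simp) (by omega) (by omega) (by omega); omega
  · have := fin 71 (by simp) (by omega) (by omega) (by omega); omega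
  · have := fin 85 (by simp) (by omega) (by omega) (by omega); omega
  · have := fin 128 (by simp) (by omega) (by omega) (by omega); omega

theorem matMul_rankLE (n : ℕ) : ∃ r, rankLE (matMulTensor 2 n n) r := by
  classical
  let eq := (Fintype.equivFin (Fin 2 × Fin n × Fin n)).symm
  refine ⟨_, fun l x => if x = ((eq l).1, (eq l).2.1) then 1 else 0,
    fun l y => if y = (eq l).2 then 1 else 0,
    fun l z => if z = ((eq l).2.2, (eq l).1) then 1 else 0, ?_⟩
  funext ⟨a, i⟩ ⟨i', j⟩ ⟨j', a'⟩
  rw [Equiv.sum_comp eq (fun s => (if (a, i) = (s.1, s.2.1) then (1 : ℂ) else 0) *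
    (if (i', j) = s.2 then 1 else 0) * (if (j', a') = (s.2.2, s.1) then 1 else 0))]
  rw [Finset.sum_eq_single (a, i', j)]
  · by_cases h1 : i = i' <;> by_cases h2 : j = j' <;> by_cases h3 : a' = a <;>
      simp [matMulTensor, h1, h2, h3, eq_comm (a := j') (b := j)]
  · rintro ⟨b, k, l⟩ _ hne
    by_cases h1 : a = b
    · by_cases h2 : (i', j) = (k, l)
      · exact absurd (by rw [h1, h2]) hne
      · simp [h2]
    · simp [h1]
  · simp

theorem no_good {n e : ℕ} (hn : 26 ≤ n) (hg : Good (matMulTensor 2 n n) e) :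
    25 * (n * n) + 33 * n + 24 < 25 * e := by
  classical
  by_contra hlt
  push Not at hlt
  obtain ⟨E, F21, F12, F22, hE, h21, h12, h22, hT, g21, g12, g22⟩ := hg
  have r0 := rank_drop E hE hT
  have t1 := test210 E F21 h21 g21
  have t2 := test120 E F12 h12 g12
  have hbd := fun (q : ℕ) => hook_bound (q := q) E F22 h22 g22
  rw [← card_lead (wt3 n) (wt3_inj n)] at r0 t1 t2
  set Y := lead (wt3 n) (E.map (tau n)) with hY
  obtain ⟨a1, a2, a3, a4⟩ := main_ineq Y (by omega) r0 t1
  rw [← card_swp Y] at r0 t2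
  obtain ⟨-, -, b3, b4⟩ := main_ineq (swp Y) (by omega) r0 t2
  rw [card_swp] at r0 b3 b4
  rw [cells_swp, card_tr] at b3 b4
  set C := cells Y with hC
  have : Nonempty (Fin n) := ⟨⟨0, by omega⟩⟩
  obtain ⟨j0, -, hj0⟩ := Finset.exists_max_image Finset.univ (fun j => colC C j) Finset.univ_nonempty
  obtain ⟨i0, -, hi0⟩ := Finset.exists_max_image Finset.univ (fun i => colC (tr C) i)
    Finset.univ_nonempty
  have c1 := Q_bound1 C i0 (colC C j0) (fun j => hj0 j (Finset.mem_univ j))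
  have c1' := Q_bound1 (tr C) j0 (colC (tr C) i0) (fun j => hi0 j (Finset.mem_univ j))
  rw [tr_tr, card_tr] at c1'
  obtain ⟨ε, w, hε, hw, hwO, hεC, c2⟩ := PQ_bound C i0 j0
  have fixsub : ∀ Q : ℕ, 2 * n * n + (2 * n - 1) * C.card ≤ (2 * n - 1) * Y.card + 4 * Q →
      2 * n * n + 2 * n * C.card + Y.card ≤ 2 * n * Y.card + C.card + 4 * Q := by
    intro Q h
    have e1 : ∀ z, (2 * n - 1) * z + z = 2 * n * z := by
      intro z
      have : 2 * n = (2 * n - 1) + 1 := by omega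
      conv_rhs => rw [this]
      ring
    have := e1 C.card
    have := e1 Y.card
    omega
  obtain ⟨hpq, rfl, rfl, hcases⟩ := num_final n Y.card C.card (colC (tr C) i0) (colC C j0) (Qs (tr C)) (Qs C)
    ε w hn (by omega) a1 a2 (fixsub _ a3) (fixsub _ b3) a4 b4 c1 c1' hε hw (by linarith)
  have hmem : (i0, j0) ∈ C := hεC.1 rfl
  have hIc : (Finset.univ.filter fun k => (k, j0) ∈ C).card = colC C j0 := by
    have := colC_tr (tr C) j0
    rw [tr_tr, Finset.sum_boole, Nat.cast_id] at this
    rw [this]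
    simp only [mem_tr]
  have hJc : (Finset.univ.filter fun j => (i0, j) ∈ C).card = colC C j0 := by
    have := colC_tr C i0
    rw [Finset.sum_boole, Nat.cast_id] at this
    rw [← this, hpq]
  have hfin := hbd _ i0 j0 _ _ (by simpa using hmem) (by simpa using hmem) hIc hJc ?_
  · rcases hcases with ⟨rfl, hq⟩ | ⟨rfl, hq⟩ | ⟨rfl, hq⟩ | ⟨rfl, hq⟩ <;> rw [hq] at hfin <;> omega
  · rintro ⟨i, j, w⟩ hy
    have hc : (i, j) ∈ C := by
      rw [hC]; simp only [cells, Finset.mem_filter, Finset.mem_univ, true_and]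
      exact ⟨w, hy⟩
    by_contra hcon
    have : (i, j) ∈ (C.filter fun c => c.1 ≠ i0 ∧ c.2 ≠ j0) := by
      simp only [Finset.mem_filter]
      refine ⟨hc, ?_, ?_⟩
      · rintro rfl; apply hcon; left; simpa using hc
      · rintro rfl; apply hcon; right; simpa using hc
    rw [eq_comm, Finset.card_eq_zero] at hwO
    rw [hwO] at this
    simp at this

/-- for `n > 25`, `BR(M⟨2,n,n⟩) ≥ n² + 1.32·n + 1`. -/
theorem borderRank_matMul_2nn (n : ℕ) (hn : 25 < n) :
    (n : ℝ) ^ 2 + 1.32 * (n : ℝ) + 1 ≤ (brank (matMulTensor 2 n n) : ℝ) := by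
  have hne : {r | matMulTensor 2 n n ∈ closure {S | rankLE S r}}.Nonempty := by
    obtain ⟨r, hr⟩ := matMul_rankLE n
    exact ⟨r, subset_closure hr⟩
  have hmem : matMulTensor 2 n n ∈ closure {S | rankLE S (brank (matMulTensor 2 n n))} :=
    Nat.sInf_mem hne
  obtain ⟨e, he, hg⟩ := good_of_closure _ _ hmem
  have h1 := no_good hn hg
  have h2 : 25 * (n * n) + 33 * n + 25 ≤ 25 * brank (matMulTensor 2 n n) := by omega
  have h3 : (25 * (n * n) + 33 * n + 25 : ℝ) ≤ 25 * brank (matMulTensor 2 n n) := by exact_mod_cast h2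
  nlinarith

end
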